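/- Let R = k[x_1,…,x_d] and let φ = [Φ₁; Φ₂] be an n×(n−1) matrix with a = d, where Φ₂ is a nonzero (n−d)×(n−1) matrix of linear forms (ε₂ = 1), I = I_{n−1}(φ) has height 2, J ⊆ I is the ideal generated by the d maximal minors of φ fixing the rows of Φ₂, and assume ht I_{n−d}(Φ₂) = d. Then J is an ideal of linear type if and only if I satisfies condition G_d. -/

import Mathlib

open Matrix MvPolynomial

noncomputable section

def idealHeight {A : Type*} [CommRing A] (I : Ideal A) : ℕ∞ :=
  ⨅ (P : PrimeSpectrum A) (_ : I ≤ P.asIdeal), Order.height P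

def minorsIdeal {A : Type*} [CommRing A] {p q : ℕ} (t : ℕ)
    (M : Matrix (Fin p) (Fin q) A) : Ideal A :=
  Ideal.span { x | ∃ (r : Fin t → Fin p) (c : Fin t → Fin q),
    Function.Injective r ∧ Function.Injective c ∧ x = (M.submatrix r c).det }

/-- Condition `G_s` of Artin–Nagata: for every prime `P ⊇ L` with `ht P ≤ s − 1`,
the localization `L_P` can be generated by at most `ht P` elements. -/
def CondG {A : Type*} [CommRing A] (L : Ideal A) (s : ℕ) : Prop :=
  ∀ P : Ideal A, P.IsPrime → L ≤ P → idealHeight P + 1 ≤ (s : ℕ∞) →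
    ∃ c : ℕ, (c : ℕ∞) ≤ idealHeight P ∧ ∃ g : Fin c → A, (∀ i, g i ∈ L) ∧
      ∀ x ∈ L, ∃ u ∉ P, u * x ∈ Ideal.span (Set.range g)

/-- The skew-symmetric matrix of signed `m × m` minors (obtained by omitting two columns)
of an `m × (m+2)` matrix; this is the middle differential of the Buchsbaum–Rim complex. -/
def bbrim {A : Type*} [CommRing A] {m : ℕ} (ψ : Matrix (Fin m) (Fin (m + 2)) A) :
    Matrix (Fin (m + 2)) (Fin (m + 2)) A :=
  Matrix.of fun i j =>
    if h : (i : ℕ) < (j : ℕ) then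
      (-1) ^ ((i : ℕ) + (j : ℕ)) *
        (ψ.submatrix id (fun q => j.succAbove
          ((⟨(i : ℕ), by have := j.isLt; omega⟩ : Fin (m + 1)).succAbove q))).det
    else if h' : (j : ℕ) < (i : ℕ) then
      (-1) ^ ((i : ℕ) + (j : ℕ) + 1) *
        (ψ.submatrix id (fun q => i.succAbove
          ((⟨(j : ℕ), by have := i.isLt; omega⟩ : Fin (m + 1)).succAbove q))).det
    else 0

def rowMap {A : Type*} [CommRing A] {ι : Type*} [Fintype ι] (g : ι → A) :
    (ι → A) →ₗ[A] A :=
  ∑ i, g i • LinearMap.proj i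

/-- Data of a (necessarily minimal) graded free resolution
`0 → ⊕_j R(−a_j) → ⊕_i R(−b_i) → I → 0` of an ideal of a polynomial ring. -/
def HasResolutionData {A : Type*} [CommRing A] {σ : Type*} (I : Ideal (MvPolynomial σ A))
    {N M : ℕ} (b : Fin N → ℕ) (a : Fin M → ℕ) : Prop :=
  ∃ (g : Fin N → MvPolynomial σ A) (φ : Matrix (Fin N) (Fin M) (MvPolynomial σ A)),
    (∀ i, (g i).IsHomogeneous (b i)) ∧ Ideal.span (Set.range g) = I ∧
    (∀ i j, (φ i j).IsHomogeneous (a j - b i) ∧ (a j ≤ b i → φ i j = 0)) ∧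
    Function.Injective φ.mulVecLin ∧
    LinearMap.range φ.mulVecLin = LinearMap.ker (rowMap g)

/-- The Castelnuovo–Mumford regularity of a codimension-two perfect ideal, read off from
its minimal graded free resolution `0 → ⊕_j R(−a_j) → ⊕_i R(−b_i) → I → 0` as
`max(max_i b_i, max_j a_j − 1)`. -/
def HasRegularity {A : Type*} [CommRing A] {σ : Type*} (I : Ideal (MvPolynomial σ A))
    (r : ℕ) : Prop :=
  ∃ (N M : ℕ) (b : Fin N → ℕ) (a : Fin M → ℕ), HasResolutionData I b a ∧
    (Finset.univ.sup b) ⊔ ((Finset.univ.sup a) - 1) = r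

def IsCohenMacaulayRing (A : Type*) [CommRing A] : Prop :=
  ∀ P : Ideal A, P.IsMaximal → ∃ rs : List A,
    (∀ x ∈ rs, x ∈ P) ∧ RingTheory.Sequence.IsRegular A rs ∧
      (rs.length : ℕ∞) = idealHeight P

def reesPresentation {A : Type*} [CommRing A] {n : ℕ} (f : Fin n → A) :
    MvPolynomial (Fin n) A →ₐ[A] Polynomial A :=
  MvPolynomial.aeval fun i => Polynomial.C (f i) * Polynomial.X

def Ideal.IsLinearType {A : Type*} [CommRing A] (I : Ideal A) : Prop :=
  ∀ (n : ℕ) (f : Fin n → A), Ideal.span (Set.range f) = I →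
    RingHom.ker (reesPresentation f) =
      Ideal.span {p | p ∈ RingHom.ker (reesPresentation f) ∧ p.IsHomogeneous 1}

def moduleDepth {A : Type*} [CommRing A] (J : Ideal A) (M : Type*)
    [AddCommGroup M] [Module A M] : ℕ∞ :=
  sSup {c : ℕ∞ | ∃ rs : List A, (∀ x ∈ rs, x ∈ J) ∧
    RingTheory.Sequence.IsRegular M rs ∧ (rs.length : ℕ∞) = c}

def analyticSpread {A : Type*} [CommRing A] (m I : Ideal A) : WithBot ℕ∞ :=
  ringKrullDim ((reesAlgebra I) ⧸ (Ideal.map (algebraMap A (reesAlgebra I)) m))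

section Points

variable {k : Type*} [Field k]

def gradedPiece (I : Ideal (MvPolynomial (Fin 3) k)) (t : ℕ) :
    Submodule k (MvPolynomial (Fin 3) k) :=
  Submodule.restrictScalars k I ⊓ homogeneousSubmodule (Fin 3) k t

def pointIdeal (p : Fin 3 → k) : Ideal (MvPolynomial (Fin 3) k) :=
  Ideal.span {f | f.IsHomogeneous 1 ∧ MvPolynomial.eval p f = 0}

def vanishingIdeal {n : ℕ} (pts : Fin n → (Fin 3 → k)) : Ideal (MvPolynomial (Fin 3) k) :=
  ⨅ i, pointIdeal (pts i)

def oneTimesPiece (I : Ideal (MvPolynomial (Fin 3) k)) (s : ℕ) :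
    Submodule k (MvPolynomial (Fin 3) k) :=
  Submodule.span k {g | ∃ ℓ f, ℓ ∈ homogeneousSubmodule (Fin 3) k 1 ∧
    f ∈ gradedPiece I s ∧ g = ℓ * f}

def IsPointFamily {n : ℕ} (pts : Fin n → (Fin 3 → k)) : Prop :=
  (∀ i, pts i ≠ 0) ∧ ∀ i j, i ≠ j → ∀ c : k, pts i ≠ c • pts j

def InGenericPosition {n : ℕ} (pts : Fin n → (Fin 3 → k)) : Prop :=
  ∀ t : ℕ, Module.finrank k (gradedPiece (vanishingIdeal pts) t) = (t + 2).choose 2 - n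

def InUniformPosition {n : ℕ} (pts : Fin n → (Fin 3 → k)) : Prop :=
  ∀ T : Finset (Fin n), ∀ t : ℕ,
    Module.finrank k (gradedPiece (⨅ i ∈ T, pointIdeal (pts i)) t) = (t + 2).choose 2 - T.card

def HasInitialDegree (I : Ideal (MvPolynomial (Fin 3) k)) (s : ℕ) : Prop :=
  gradedPiece I s ≠ ⊥ ∧ ∀ t < s, gradedPiece I t = ⊥

def InTightGenericPosition {n : ℕ} (pts : Fin n → (Fin 3 → k)) (s : ℕ) : Prop :=
  InGenericPosition pts ∧
    Module.finrank k (oneTimesPiece (vanishingIdeal pts) s) =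
      min (3 * Module.finrank k (gradedPiece (vanishingIdeal pts) s))
        (Module.finrank k (gradedPiece (vanishingIdeal pts) (s + 1)))

def IsBirationalOntoImage {N : ℕ} (f : Fin N → MvPolynomial (Fin 3) k) : Prop :=
  ∃ (e : ℕ) (G : Fin 3 → MvPolynomial (Fin N) k) (w : MvPolynomial (Fin 3) k),
    w ≠ 0 ∧ (∀ j, (G j).IsHomogeneous e) ∧
      ∀ j, MvPolynomial.aeval f (G j) = w * MvPolynomial.X j

end Points

end

universe u

open RingTheory.Sequence IsLocalRing in
/-- A regular local ring is a domain, and its maximal ideal contains a weakly regular sequence of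
length the dimension. -/
theorem IsRegularLocalRing.isDomain_and_exists_isWeaklyRegular (n : ℕ) :
    ∀ (A : Type*) [CommRing A] [IsRegularLocalRing A], ringKrullDim A = n →
      IsDomain A ∧ ∃ rs : List A, rs.length = n ∧ (∀ x ∈ rs, x ∈ maximalIdeal A) ∧
        IsWeaklyRegular A rs := by
  induction n with
  | zero =>
    intro A _ _ h
    have h0 := IsRegularLocalRing.spanFinrank_maximalIdeal (R := A)
    rw [h] at h0
    have h1 : (maximalIdeal A).spanFinrank = 0 := by exact_mod_cast h0
    rw [Submodule.spanFinrank_eq_zero_iff_eq_bot (IsNoetherian.noetherian _)] at h1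
    have := (isField_iff_maximalIdeal_eq.2 h1)
    exact ⟨this.isDomain, [], rfl, by simp, by simp⟩
  | succ n ih =>
    intro A _ _ h
    classical
    have h0 := IsRegularLocalRing.spanFinrank_maximalIdeal (R := A)
    rw [h] at h0
    have h1 : (maximalIdeal A).spanFinrank = n + 1 := by exact_mod_cast h0
    have fg : (maximalIdeal A).FG := IsNoetherian.noetherian _
    obtain ⟨s, hscard, hs⟩ := Submodule.FG.exists_span_finset_card_eq_spanFinrank fg
    rw [h1] at hscard
    have hsq : ¬ maximalIdeal A ≤ maximalIdeal A * maximalIdeal A := by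
      intro hle
      have := Submodule.eq_bot_of_le_smul_of_le_jacobson_bot (maximalIdeal A) (maximalIdeal A) fg
        hle (IsLocalRing.maximalIdeal_le_jacobson _)
      rw [this, Submodule.spanFinrank_bot] at h1
      omega
    have hmin : ∀ Q ∈ minimalPrimes A, ¬ maximalIdeal A ≤ Q := by
      intro Q hQ hle
      have hQp := hQ.1.1
      have : maximalIdeal A = Q := le_antisymm hle (IsLocalRing.le_maximalIdeal hQp.ne_top)
      have h2 := IsLocalRing.maximalIdeal_height_eq_ringKrullDim (R := A)
      rw [this, Ideal.height_eq_zero_iff.2 hQ, h] at h2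
      exact absurd h2.symm (by exact_mod_cast Nat.succ_ne_zero n)
    have hfin : (minimalPrimes A).Finite := Ideal.finite_minimalPrimes_of_isNoetherianRing A ⊥
    have havoid : ¬ ((maximalIdeal A : Set A) ⊆
        ⋃ i ∈ (↑(insert (maximalIdeal A * maximalIdeal A) hfin.toFinset) : Set (Ideal A)), i) := by
      rw [Ideal.subset_union_prime (f := fun i => i) (maximalIdeal A * maximalIdeal A)
        (maximalIdeal A * maximalIdeal A)]
      · rintro ⟨Q, hQ, hle⟩
        rcases Finset.mem_insert.1 hQ with rfl | hQ
        · exact hsq hle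
        · exact hmin Q (hfin.mem_toFinset.1 hQ) hle
      · intro i hi hne _
        exact (hfin.mem_toFinset.1 ((Finset.mem_insert.1 hi).resolve_left hne)).1.1
    obtain ⟨x, hxm, hx⟩ := Set.not_subset.1 havoid
    have hx2 : x ∉ maximalIdeal A * maximalIdeal A := fun h' => hx (by
      simp only [Set.mem_iUnion]; exact ⟨_, by simp, h'⟩)
    have hxmin : ∀ Q ∈ minimalPrimes A, x ∉ Q := fun Q hQ h' => hx (by
      simp only [Set.mem_iUnion]; exact ⟨Q, by
        rw [Finset.mem_coe, Finset.mem_insert]; exact Or.inr (hfin.mem_toFinset.2 hQ), h'⟩)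
    have hxs : x ∈ Submodule.span A (s : Set A) := by rw [hs]; exact hxm
    obtain ⟨c, hc⟩ := Submodule.mem_span_finset'.1 hxs
    have hsm : ∀ y ∈ s, y ∈ maximalIdeal A := fun y hy => by
      rw [← hs]; exact Submodule.subset_span hy
    obtain ⟨y, hy⟩ : ∃ y : s, IsUnit (c y) := by
      by_contra! hcon
      apply hx2
      rw [← hc]
      refine Ideal.sum_mem _ fun y _ => ?_
      exact Ideal.mul_mem_mul ((mem_maximalIdeal _).2 (hcon y)) (hsm y y.2)
    set π := Ideal.Quotient.mk (Ideal.span {x}) with hπ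
    have hxtop : Ideal.span {x} ≠ ⊤ := fun h' =>
      (maximalIdeal.isMaximal A).ne_top (top_le_iff.1 (h' ▸ (Ideal.span_le.2 (by simpa))))
    have : Nontrivial (A ⧸ Ideal.span {x}) := Ideal.Quotient.nontrivial_iff.2 hxtop
    have hloc : IsLocalRing (A ⧸ Ideal.span {x}) :=
      IsLocalRing.of_surjective' π Ideal.Quotient.mk_surjective
    have hmap : maximalIdeal (A ⧸ Ideal.span {x}) =
        Submodule.span _ (((s.erase y).image π : Finset _) : Set (A ⧸ Ideal.span {x})) := by
      have e1 : maximalIdeal (A ⧸ Ideal.span {x}) = (maximalIdeal A).map π :=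
        (IsLocalRing.map_maximalIdeal_of_surjective π Ideal.Quotient.mk_surjective).symm
      rw [e1]
      apply le_antisymm
      · rw [← hs, Ideal.map_le_iff_le_comap]
        have hle : ∀ z ∈ s.erase (y : A), π z ∈ Ideal.span
            (((s.erase y).image π : Finset _) : Set (A ⧸ Ideal.span {x})) := by
          intro z hz
          exact Ideal.subset_span (by simpa using ⟨z, by simpa [and_comm] using hz, rfl⟩)
        refine Submodule.span_le.2 fun z hz => ?_
        by_cases hzy : z = y
        · subst hzy
          have h3 : π (c y * y) = - ∑ w ∈ Finset.univ.erase y, π (c w * w) := by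
            rw [eq_neg_iff_add_eq_zero, ← map_sum, ← map_add,
              Finset.add_sum_erase _ (fun w : s => c w * (w : A)) (Finset.mem_univ y)]
            have : ∑ w : s, c w * (w : A) = x := hc
            rw [this, hπ, Ideal.Quotient.eq_zero_iff_mem]
            exact Ideal.mem_span_singleton_self x
          change π y ∈ Ideal.span
              (((s.erase y).image π : Finset _) : Set (A ⧸ Ideal.span {x}))
          have h4 : π (c y * y) ∈ Ideal.span
              (((s.erase y).image π : Finset _) : Set (A ⧸ Ideal.span {x})) := by
            rw [h3]
            refine neg_mem (Ideal.sum_mem _ fun w hw => ?_)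
            rw [map_mul]
            refine Ideal.mul_mem_left _ _ (hle _ ?_)
            simp only [Finset.mem_erase, Finset.mem_univ, and_true, ne_eq] at hw ⊢
            exact ⟨fun h' => hw (Subtype.ext h'), w.2⟩
          rw [map_mul] at h4
          exact (Ideal.unit_mul_mem_iff_mem _ (hy.map π)).1 h4
        · exact hle z (by simp [hzy]; exact hz)
      · refine Submodule.span_le.2 fun z hz => ?_
        simp only [Finset.coe_image, Set.mem_image] at hz
        obtain ⟨w, hw, rfl⟩ := hz
        exact Ideal.mem_map_of_mem _ (hsm w (Finset.mem_of_mem_erase (Finset.mem_coe.1 hw)))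
    have hrank : (maximalIdeal (A ⧸ Ideal.span {x})).spanFinrank ≤ n := by
      rw [hmap]
      refine (Submodule.spanFinrank_span_le_ncard_of_finite (Finset.finite_toSet _)).trans ?_
      rw [Set.ncard_coe_finset]
      refine Finset.card_image_le.trans ?_
      rw [Finset.card_erase_of_mem y.2, hscard]; simp
    have hdim : (n : WithBot ℕ∞) ≤ ringKrullDim (A ⧸ Ideal.span {x}) := by
      have h3 := ringKrullDim_le_ringKrullDim_quotient_add_card ({x} : Finset A) (by
        simpa using (IsLocalRing.ringJacobson_eq_maximalIdeal (R := A)) ▸ hxm)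
      rw [Finset.coe_singleton, Finset.card_singleton, h, Nat.cast_add, Nat.cast_one] at h3
      exact ENat.WithBot.add_le_add_one_right_iff.1 h3
    have hreg : IsRegularLocalRing (A ⧸ Ideal.span {x}) :=
      IsRegularLocalRing.of_spanFinrank_maximalIdeal_le _
        ((by exact_mod_cast hrank : _ ≤ (n : WithBot ℕ∞)).trans hdim)
    have hdim' : ringKrullDim (A ⧸ Ideal.span {x}) = n := by
      refine le_antisymm ?_ hdim
      rw [← hreg.spanFinrank_maximalIdeal]; exact_mod_cast hrank
    obtain ⟨hdom, rs, hlen, hrm, hrw⟩ := ih (A ⧸ Ideal.span {x}) hdim'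
    have hxprime : (Ideal.span {x}).IsPrime := (Ideal.Quotient.isDomain_iff_prime _).1 hdom
    obtain ⟨Q, hQ, hQx⟩ := Ideal.exists_minimalPrimes_le (bot_le : ⊥ ≤ Ideal.span {x})
    have hQp := hQ.1.1
    have hQ0 : Q = ⊥ := by
      refine Submodule.eq_bot_of_le_smul_of_le_jacobson_bot (maximalIdeal A) Q
        (IsNoetherian.noetherian _) ?_ (IsLocalRing.maximalIdeal_le_jacobson _)
      intro q hq
      obtain ⟨a, rfl⟩ := Ideal.mem_span_singleton'.1 (hQx hq)
      have ha : a ∈ Q := (hQp.mem_or_mem hq).resolve_right (hxmin Q hQ)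
      rw [mul_comm]
      exact Submodule.smul_mem_smul hxm ha
    have hAdom : IsDomain A := by
      rw [hQ0] at hQp
      exact (IsDomain.of_bot_isPrime A)
    refine ⟨hAdom, ?_⟩
    choose g hg using (Ideal.Quotient.mk_surjective (I := Ideal.span {x}))
    refine ⟨x :: rs.map g, by simp [hlen], ?_, ?_⟩
    · intro z hz
      rcases List.mem_cons.1 hz with rfl | hz
      · exact hxm
      obtain ⟨w, hw, rfl⟩ := List.mem_map.1 hz
      refine (mem_maximalIdeal _).2 fun hu => (mem_maximalIdeal _).1 (hrm w hw) ?_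
      rw [← hg w]
      exact hu.map _
    · rw [isWeaklyRegular_cons_iff]
      constructor
      · have hx0 : x ≠ 0 := fun h' => hx2 (h' ▸ zero_mem _)
        exact fun a b hab => mul_left_cancel₀ hx0 hab
      · let e : QuotSMulTop x A ≃ₗ[A] A ⧸ Ideal.span {x} :=
          Submodule.quotEquivOfEq _ _ (by
            rw [← Submodule.ideal_span_singleton_smul]; simp)
        rw [e.isWeaklyRegular_congr, ← isWeaklyRegular_map_algebraMap_iff (A ⧸ Ideal.span {x})]
        have : (rs.map g).map (algebraMap A (A ⧸ Ideal.span {x})) = rs := by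
          rw [List.map_map]
          conv_rhs => rw [← List.map_id rs]
          exact List.map_congr_left fun a _ => hg a
        rw [this]
        exact hrw

open RingTheory.Sequence in
/-- Acyclicity lemma for the augmentation position: an exact complex of modules on which `rs` is
weakly regular and which is shorter than `rs` has no `rs`-torsion in its cokernel. -/
theorem exists_of_smul_mem_range_of_exact {S : Type*} [CommRing S] (rs : List S) :
    ∀ (F : ℕ → Type*) [∀ i, AddCommGroup (F i)] [∀ i, Module S (F i)]
      (D : ∀ i, F (i + 1) →ₗ[S] F i) (_ : ∀ i x, D i (D (i + 1) x) = 0)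
      (_ : ∀ i x, D i x = 0 → ∃ y, D (i + 1) y = x)
      (_ : ∀ i, rs.length ≤ i → Subsingleton (F i))
      (_ : ∀ i, IsWeaklyRegular (F i) rs)
      (u : F 0) (_ : ∀ y ∈ rs, ∃ w, D 0 w = y • u), ∃ w, D 0 w = u := by
  induction rs with
  | nil =>
    intro F _ _ D _ _ hb _ u _
    have := hb 0 le_rfl
    exact ⟨0, Subsingleton.elim _ _⟩
  | cons y rs ih =>
    intro F _ _ D hc hex hb hreg u hu
    simp_rw [isWeaklyRegular_cons_iff] at hreg
    have hy : ∀ i (a b : F i), y • a = y • b → a = b := fun i a b h => (hreg i).1 h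
    have hmem : ∀ i (a : F i), (Submodule.Quotient.mk a : QuotSMulTop y (F i)) = 0 ↔
        ∃ b, y • b = a := by
      intro i a
      rw [Submodule.Quotient.mk_eq_zero]
      simp [Submodule.mem_smul_pointwise_iff_exists]
    have key := ih (fun i => QuotSMulTop y (F (i + 1))) (fun i => QuotSMulTop.map y (D (i + 1)))
      ?_ ?_ ?_ (fun i => (hreg (i + 1)).2)
    · obtain ⟨w, hw⟩ := hu y (by simp)
      obtain ⟨v, hv⟩ := key (Submodule.Quotient.mk w) (by
        intro z hz
        obtain ⟨t, ht⟩ := hu z (by simp [hz])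
        obtain ⟨v, hv⟩ := hex 0 (y • t - z • w) (by
          simp only [map_sub, map_smul, ht, hw]; rw [smul_comm, sub_self])
        refine ⟨Submodule.Quotient.mk (-v), ?_⟩
        change Submodule.Quotient.mk (D 1 (-v)) = _
        rw [← Submodule.Quotient.mk_smul, ← sub_eq_zero, ← Submodule.Quotient.mk_sub, hmem]
        refine ⟨-t, ?_⟩
        rw [map_neg, hv]; simp)
      obtain ⟨v, rfl⟩ := Submodule.Quotient.mk_surjective _ v
      change Submodule.Quotient.mk (D 1 v) = _ at hv
      rw [← sub_eq_zero, ← Submodule.Quotient.mk_sub, hmem] at hv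
      obtain ⟨b, hb⟩ := hv
      refine ⟨-b, hy 0 _ _ ?_⟩
      rw [← map_smul, smul_neg, hb, neg_sub, map_sub, hc, hw, sub_zero]
    · intro i x
      obtain ⟨x, rfl⟩ := Submodule.Quotient.mk_surjective _ x
      change Submodule.Quotient.mk (D (i + 1) (D (i + 2) x)) = _
      rw [hc, Submodule.Quotient.mk_zero]
    · intro i x hx
      obtain ⟨x, rfl⟩ := Submodule.Quotient.mk_surjective _ x
      change Submodule.Quotient.mk (D (i + 1) x) = _ at hx
      obtain ⟨w, hw⟩ := (hmem _ _).1 hx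
      obtain ⟨v, hv⟩ := hex i w (hy _ _ _ (by rw [← map_smul, hw, hc, smul_zero]))
      obtain ⟨t, ht⟩ := hex (i + 1) (x - y • v) (by rw [map_sub, map_smul, hv, hw, sub_self])
      refine ⟨Submodule.Quotient.mk t, ?_⟩
      change Submodule.Quotient.mk (D (i + 2) t) = _
      rw [← sub_eq_zero, ← Submodule.Quotient.mk_sub, hmem]
      exact ⟨-v, by rw [ht]; simp⟩
    · intro i hi
      have := hb (i + 1) (by simpa using hi)
      exact (Submodule.Quotient.mk_surjective _).subsingleton

open RingTheory.Sequence in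
theorem exact_of_smul_exact {S : Type*} [CommRing S] (rs : List S)
    (F : ℕ → Type*) [∀ i, AddCommGroup (F i)] [∀ i, Module S (F i)]
    (D : ∀ i, F (i + 1) →ₗ[S] F i) (hc : ∀ i x, D i (D (i + 1) x) = 0)
    (hkill : ∀ y ∈ rs, ∀ i x, D i x = 0 → ∃ z, D (i + 1) z = y • x)
    (hb : ∀ i, rs.length < i → Subsingleton (F i))
    (hreg : ∀ i, IsWeaklyRegular (F i) rs) (i : ℕ) (x : F (i + 1)) (hx : D i x = 0) :
    ∃ y, D (i + 1) y = x := by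
  induction h : rs.length - i using Nat.strong_induction_on generalizing i with
  | _ n ih =>
    by_cases hi : rs.length ≤ i
    · have := hb (i + 1) (by omega)
      exact ⟨0, Subsingleton.elim _ _⟩
    exact exists_of_smul_mem_range_of_exact rs (fun j => F (i + 1 + j)) (fun j => D (i + 1 + j))
      (fun j => hc _) (fun j y hy => ih _ (by omega) (i + 1 + j) y hy rfl)
      (fun j hj => hb _ (by omega)) (fun j => hreg _) x (fun y hy => hkill y hy i x hx)

open RingTheory.Sequence in
theorem RingTheory.Sequence.IsWeaklyRegular.of_flat_module {S M : Type*} [CommRing S]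
    [AddCommGroup M]
    [Module S M] [Module.Flat S M] {rs : List S} (h : IsWeaklyRegular S rs) :
    IsWeaklyRegular M rs :=
  ((TensorProduct.rid S M).isWeaklyRegular_congr rs).1 (h.isWeaklyRegular_lTensor (M₂ := M))

namespace AlternatingMap

variable {S V : Type*} [CommRing S] [AddCommGroup V] [Module S V]

/-- Contraction of an alternating form with a vector. -/
def contract {n : ℕ} (v : V) : (V [⋀^Fin (n + 1)]→ₗ[S] S) →ₗ[S] (V [⋀^Fin n]→ₗ[S] S) :=
  curryLeftLinearMap.flip v

/-- Exterior multiplication of an alternating form by a linear form. -/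
def wedge {n : ℕ} (X : V →ₗ[S] S) : (V [⋀^Fin n]→ₗ[S] S) →ₗ[S] (V [⋀^Fin (n + 1)]→ₗ[S] S) :=
  alternatizeUncurryFinLM ∘ₗ LinearMap.smulRightₗ X

theorem contract_apply {n : ℕ} (v : V) (f : V [⋀^Fin (n + 1)]→ₗ[S] S) (w : Fin n → V) :
    contract v f w = f (Matrix.vecCons v w) := rfl

theorem wedge_apply {n : ℕ} (X : V →ₗ[S] S) (f : V [⋀^Fin n]→ₗ[S] S) (w : Fin (n + 1) → V) :
    wedge X f w = ∑ i : Fin (n + 1), (-1) ^ (i : ℕ) * (X (w i) * f (i.removeNth w)) := by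
  simp [wedge, alternatizeUncurryFin_apply]

theorem wedge_zero {n : ℕ} (X : V →ₗ[S] S) : wedge X (0 : V [⋀^Fin n]→ₗ[S] S) = 0 :=
  (wedge X).map_zero

theorem contract_wedge {n : ℕ} (X : V →ₗ[S] S) (v : V) (f : V [⋀^Fin (n + 1)]→ₗ[S] S) :
    contract v (wedge X f) = X v • f - wedge X (contract v f) := by
  ext w
  rw [contract_apply, wedge_apply, Fin.sum_univ_succ, sub_apply, smul_apply, wedge_apply,
    sub_eq_add_neg, ← Finset.sum_neg_distrib]
  congr 1
  · simp [Fin.removeNth_zero]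
  · refine Finset.sum_congr rfl fun i _ => ?_
    rw [contract_apply]
    have : i.succ.removeNth (Matrix.vecCons v w) = Matrix.vecCons v (i.removeNth w) := by
      ext j
      refine Fin.cases ?_ (fun j => ?_) j
      · simp [Fin.removeNth]
      · simp [Fin.removeNth]
    rw [this]
    simp [pow_succ]

theorem contract_wedge_zero (X : V →ₗ[S] S) (v : V) (f : V [⋀^Fin 0]→ₗ[S] S) :
    contract v (wedge X f) = X v • f := by
  ext w
  rw [contract_apply, wedge_apply, Fin.sum_univ_succ, smul_apply]
  simp only [Finset.univ_eq_empty, Finset.sum_empty, add_zero]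
  rw [Subsingleton.elim ((0 : Fin 1).removeNth (Matrix.vecCons v w)) w]
  simp

theorem contract_contract {n : ℕ} (v w : V) (f : V [⋀^Fin (n + 2)]→ₗ[S] S) :
    contract v (contract w f) = - contract w (contract v f) := by
  have hs : ∀ x, contract x (contract x f) = 0 := fun x => curryLeft_same f x
  have hadd : ∀ {m : ℕ} (g : V [⋀^Fin (m + 1)]→ₗ[S] S),
      contract (v + w) g = contract v g + contract w g := fun g => map_add g.curryLeft v w
  have h := hs (v + w)
  rw [hadd, hadd, map_add, map_add, hs, hs, zero_add, add_zero] at h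
  exact eq_neg_of_add_eq_zero_left h

theorem ext_contract {n : ℕ} {f g : V [⋀^Fin (n + 1)]→ₗ[S] S}
    (h : ∀ v, contract v f = contract v g) : f = g := by
  ext w
  have := congrArg (fun F => F (Fin.tail w)) (h (w 0))
  simp only [contract_apply] at this
  rwa [show Matrix.vecCons (w 0) (Fin.tail w) = w from Fin.cons_self_tail w] at this

theorem wedge_wedge {n : ℕ} (X Y : V →ₗ[S] S) (f : V [⋀^Fin n]→ₗ[S] S) :
    wedge X (wedge Y f) = - wedge Y (wedge X f) := by
  induction n with
  | zero =>
    refine ext_contract fun v => ?_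
    simp only [map_neg, contract_wedge, contract_wedge_zero, map_smul]
    abel
  | succ n ih =>
    refine ext_contract fun v => ?_
    simp only [map_neg, contract_wedge, map_sub, map_smul]
    rw [ih]
    abel

/-- The projection operator `X ∧ ι_v`. -/
def proj {n : ℕ} (X : V →ₗ[S] S) (v : V) : (V [⋀^Fin (n + 1)]→ₗ[S] S) →ₗ[S]
    (V [⋀^Fin (n + 1)]→ₗ[S] S) := wedge X ∘ₗ contract v

theorem proj_apply {n : ℕ} (X : V →ₗ[S] S) (v : V) (f : V [⋀^Fin (n + 1)]→ₗ[S] S) :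
    proj X v f = wedge X (contract v f) := rfl

theorem proj_proj_self {n : ℕ} (X : V →ₗ[S] S) (v : V) (f : V [⋀^Fin (n + 1)]→ₗ[S] S) :
    proj X v (proj X v f) = X v • proj X v f := by
  rcases n with _ | n
  · simp only [proj_apply, contract_wedge_zero, map_smul]
  · have h : contract v (contract v f) = 0 := curryLeft_same f v
    simp only [proj_apply, contract_wedge, map_smul, h, wedge_zero, sub_zero]

theorem proj_comm {n : ℕ} (X Y : V →ₗ[S] S) (v w : V) (hX : X w = 0) (hY : Y v = 0)
    (f : V [⋀^Fin (n + 1)]→ₗ[S] S) :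
    proj X v (proj Y w f) = proj Y w (proj X v f) := by
  rcases n with _ | n
  · simp only [proj_apply, contract_wedge_zero, hX, hY, zero_smul, wedge_zero]
  · simp only [proj_apply, contract_wedge, hX, hY, zero_smul, zero_sub, map_neg]
    rw [contract_contract, wedge_wedge]
    simp

theorem contract_proj {n : ℕ} (X : V →ₗ[S] S) (v w : V) (hX : X w = 0)
    (f : V [⋀^Fin (n + 2)]→ₗ[S] S) :
    contract w (proj X v f) = proj X v (contract w f) := by
  simp only [proj_apply, contract_wedge, hX, zero_smul, zero_sub]
  rw [contract_contract, map_neg, neg_neg]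

/-- A form of degree `n + 1` divisible by `n + 1` linear forms vanishes up to torsion as soon as
it vanishes on a family of vectors dual to the linear forms. -/
theorem pow_smul_eq_zero_of_proj {δ : S} {n : ℕ} (Y : Fin (n + 1) → V →ₗ[S] S)
    (Θ : Fin (n + 1) → V) (hY : ∀ j k, j ≠ k → Y k (Θ j) = 0) (f : V [⋀^Fin (n + 1)]→ₗ[S] S)
    (hf : ∀ k, δ • f = proj (Y k) (Θ k) f) (h0 : f Θ = 0) : δ ^ (n + 1) • f = 0 := by
  suffices h : δ ^ n • contract (Θ 0) f = 0 by
    rw [pow_succ, mul_smul, hf 0, proj_apply, ← map_smul, h, wedge_zero]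
  have hc : contract (Θ 0) f (Fin.tail Θ) = 0 := by
    rw [contract_apply, ← h0]
    congr 1
    exact Fin.cons_self_tail Θ
  induction n with
  | zero =>
    ext w
    rw [pow_zero, one_smul, Subsingleton.elim w (Fin.tail Θ), hc]; rfl
  | succ n ih =>
    have hf' : ∀ k : Fin (n + 1),
        δ • contract (Θ 0) f = proj (Y k.succ) (Θ k.succ) (contract (Θ 0) f) := fun k => by
      rw [← contract_proj _ _ _ (hY _ _ (Fin.succ_ne_zero k).symm), ← hf k.succ, map_smul]
    have h := ih (Fin.tail Y) (Fin.tail Θ)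
      (fun j k hjk => hY _ _ (fun h => hjk (Fin.succ_injective _ h))) _ hf' hc
      (by rw [contract_apply, ← hc]; congr 1; exact Fin.cons_self_tail _)
    rw [pow_succ, mul_smul, hf' 0, proj_apply, ← map_smul]
    exact (congrArg _ h).trans (wedge_zero _)

end AlternatingMap

namespace EagonNorthcott
open AlternatingMap

variable {S V ι : Type*} [CommRing S] [AddCommGroup V] [Module S V]

/-- The Eagon–Northcott differential on families of alternating forms indexed by monomials. -/
def diff [Fintype ι] (Ψ : ι → V) {n : ℕ} : (Multiset ι → V [⋀^Fin (n + 1)]→ₗ[S] S) →ₗ[S]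
    (Multiset ι → V [⋀^Fin n]→ₗ[S] S) :=
  LinearMap.pi fun a => ∑ k, contract (Ψ k) ∘ₗ LinearMap.proj (k ::ₘ a)

theorem diff_apply [Fintype ι] (Ψ : ι → V) {n : ℕ} (f : Multiset ι → V [⋀^Fin (n + 1)]→ₗ[S] S)
    (a : Multiset ι) : diff Ψ f a = ∑ k, contract (Ψ k) (f (k ::ₘ a)) := by
  simp [diff]

theorem diff_diff [Fintype ι] (Ψ : ι → V) {n : ℕ} (f : Multiset ι → V [⋀^Fin (n + 2)]→ₗ[S] S) :
    diff Ψ (diff Ψ f) = 0 := by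
  funext a
  simp only [diff_apply, map_sum, Pi.zero_apply]
  rw [← Finset.sum_product', Finset.sum_involution (fun x _ => (x.2, x.1))]
  · rintro ⟨j, k⟩ -
    rw [contract_contract, Multiset.cons_swap]
    simp
  · rintro ⟨j, k⟩ - hne
    intro h
    obtain rfl : j = k := congrArg Prod.snd h
    exact hne (curryLeft_same _ _)
  · simp
  · simp

/-- The homotopy associated with a linear form `X` dual to the `k`-th row. -/
def homotopy [DecidableEq ι] (X : V →ₗ[S] S) (k : ι) {n : ℕ} (f : Multiset ι → V [⋀^Fin n]→ₗ[S] S) :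
    Multiset ι → V [⋀^Fin (n + 1)]→ₗ[S] S :=
  fun a => if k ∈ a then wedge X (f (a.erase k)) else 0

/-- The residual part of the homotopy. -/
def residue [DecidableEq ι] (X : V →ₗ[S] S) (v : V) (k : ι) {n : ℕ}
    (f : Multiset ι → V [⋀^Fin (n + 1)]→ₗ[S] S) : Multiset ι → V [⋀^Fin (n + 1)]→ₗ[S] S :=
  fun a => if k ∈ a then 0 else AlternatingMap.proj X v (f a)

theorem homotopy_zero [DecidableEq ι] (X : V →ₗ[S] S) (k : ι) {n : ℕ} :
    homotopy X k (0 : Multiset ι → V [⋀^Fin n]→ₗ[S] S) = 0 := by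
  funext a
  simp [homotopy, wedge_zero]

theorem diff_homotopy [Fintype ι] [DecidableEq ι] {δ : S} (Ψ : ι → V) (X : V →ₗ[S] S) (k : ι)
    (hk : X (Ψ k) = δ)
    (hX : ∀ j, j ≠ k → X (Ψ j) = 0) {n : ℕ} (f : Multiset ι → V [⋀^Fin (n + 1)]→ₗ[S] S) :
    δ • f = diff Ψ (homotopy X k f) + homotopy X k (diff Ψ f) + residue X (Ψ k) k f := by
  funext a
  simp only [Pi.add_apply, Pi.smul_apply, diff_apply, homotopy, residue]
  rw [← Finset.add_sum_erase _ _ (Finset.mem_univ k), if_pos (Multiset.mem_cons_self k a),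
    Multiset.erase_cons_head, contract_wedge, hk]
  have h1 : ∀ j ∈ Finset.univ.erase k,
      contract (Ψ j) (if k ∈ j ::ₘ a then wedge X (f ((j ::ₘ a).erase k)) else 0) =
      if k ∈ a then - wedge X (contract (Ψ j) (f (j ::ₘ a.erase k))) else 0 := by
    intro j hj
    have hjk : j ≠ k := Finset.ne_of_mem_erase hj
    by_cases ha : k ∈ a
    · rw [if_pos ha, if_pos (Multiset.mem_cons_of_mem ha), Multiset.erase_cons_tail _ hjk,
        contract_wedge, hX j hjk, zero_smul, zero_sub]
    · rw [if_neg ha, if_neg (by simp [ha, hjk.symm]), _root_.map_zero]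
  rw [Finset.sum_congr rfl h1]
  by_cases ha : k ∈ a
  · simp only [if_pos ha]
    rw [map_sum, ← Finset.add_sum_erase _ _ (Finset.mem_univ k), Multiset.cons_erase ha,
      Finset.sum_neg_distrib]
    abel
  · simp only [if_neg ha]
    rw [Finset.sum_const_zero, proj_apply]
    abel

/-- Iterating the homotopy over all rows kills homology up to the part supported at `0`. -/
theorem exists_diff_of_cycle [Fintype ι] [DecidableEq ι] {δ : S} (Ψ : ι → V) (X : ι → V →ₗ[S] S)
    (hX : ∀ j k, X k (Ψ j) = if j = k then δ else 0) {n : ℕ}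
    (f : Multiset ι → V [⋀^Fin (n + 1)]→ₗ[S] S) (hf : diff Ψ f = 0) (l : List ι) :
    ∃ (g : Multiset ι → V [⋀^Fin (n + 2)]→ₗ[S] S) (r : Multiset ι → V [⋀^Fin (n + 1)]→ₗ[S] S),
      δ ^ l.length • f = diff Ψ g + r ∧ diff Ψ r = 0 ∧ (∀ a, f a = 0 → r a = 0) ∧
      (∀ a, ∀ k ∈ l, k ∈ a → r a = 0) ∧
      ∀ k ∈ l, δ • r 0 = AlternatingMap.proj (X k) (Ψ k) (r 0) := by
  induction l with
  | nil => exact ⟨0, f, by simp, hf, by simp, by simp, by simp⟩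
  | cons k l ih =>
    obtain ⟨g, r, h1, h2, h3, h4, h5⟩ := ih
    have hk := diff_homotopy Ψ (X k) k (by simpa using hX k k)
      (fun j hj => by rw [hX, if_neg hj]) r
    rw [h2, homotopy_zero, add_zero] at hk
    refine ⟨δ • g + homotopy (X k) k r, residue (X k) (Ψ k) k r, ?_, ?_, ?_, ?_, ?_⟩
    · rw [List.length_cons, pow_succ', mul_smul, h1, smul_add, hk, map_add, map_smul]
      exact (add_assoc _ _ _).symm
    · have := congrArg (diff Ψ) hk
      rwa [map_smul, h2, smul_zero, map_add, diff_diff, zero_add, eq_comm] at this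
    · intro a ha
      simp [residue, h3 a ha]
    · intro a j hj hja
      rcases List.mem_cons.1 hj with rfl | hj
      · simp [residue, hja]
      · simp [residue, h4 a j hj hja]
    · intro j hj
      have h0 : residue (X k) (Ψ k) k r 0 = AlternatingMap.proj (X k) (Ψ k) (r 0) := by
        simp [residue]
      rw [h0]
      by_cases hjk : j = k
      · subst hjk
        rw [proj_proj_self, hX, if_pos rfl]
      · have hj' := (List.mem_cons.1 hj).resolve_left hjk
        rw [proj_comm _ _ _ _ (by rw [hX, if_neg (Ne.symm hjk)]) (by rw [hX, if_neg hjk]),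
          ← h5 j hj', map_smul]

end EagonNorthcott

namespace EagonNorthcott
open AlternatingMap RingTheory.Sequence

section Sym

variable {ι : Type} {A : Type*} [AddCommGroup A]

/-- Extension by zero of a family indexed by monomials of fixed degree. -/
def extend (S : Type*) [CommRing S] [Module S A] (i : ℕ) :
    (Sym ι i → A) →ₗ[S] (Multiset ι → A) where
  toFun f a := if h : a.card = i then f ⟨a, h⟩ else 0
  map_add' f g := by
    funext a
    by_cases h : a.card = i <;> simp [h]
    rfl
  map_smul' c f := by
    funext a
    by_cases h : a.card = i <;> simp [h]
    rfl

/-- Restriction of a family to the monomials of fixed degree. -/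
def restrict (S : Type*) [CommRing S] [Module S A] (i : ℕ) :
    (Multiset ι → A) →ₗ[S] (Sym ι i → A) where
  toFun f a := f a
  map_add' _ _ := rfl
  map_smul' _ _ := rfl

variable {S : Type*} [CommRing S] [Module S A]

theorem extend_of_ne {i : ℕ} (f : Sym ι i → A) {a : Multiset ι} (h : a.card ≠ i) :
    extend S i f a = 0 := dif_neg h

theorem restrict_extend (i : ℕ) (f : Sym ι i → A) : restrict S i (extend S i f) = f := by
  funext a
  exact dif_pos a.2

theorem extend_restrict (i : ℕ) (f : Multiset ι → A) (hf : ∀ a, a.card ≠ i → f a = 0) :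
    extend S i (restrict S i f) = f := by
  funext a
  by_cases h : a.card = i
  · exact dif_pos h
  · rw [extend_of_ne _ h, hf a h]

end Sym

variable {S : Type u} [CommRing S] {q e : ℕ}

/-- The terms of the Eagon–Northcott complex of an `(e + 1) × q` matrix. -/
def Term (S : Type u) [CommRing S] (q e : ℕ) : ℕ → Type u
  | 0 => S
  | i + 1 => Sym (Fin (e + 1)) i → (Fin q → S) [⋀^Fin (e + i + 1)]→ₗ[S] S

instance : ∀ i, AddCommGroup (Term S q e i)
  | 0 => inferInstanceAs (AddCommGroup S)
  | i + 1 => inferInstanceAs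
      (AddCommGroup (Sym (Fin (e + 1)) i → (Fin q → S) [⋀^Fin (e + i + 1)]→ₗ[S] S))

instance : ∀ i, Module S (Term S q e i)
  | 0 => inferInstanceAs (Module S S)
  | i + 1 => inferInstanceAs
      (Module S (Sym (Fin (e + 1)) i → (Fin q → S) [⋀^Fin (e + i + 1)]→ₗ[S] S))

instance : ∀ i, Module.Flat S (Term S q e i)
  | 0 => inferInstanceAs (Module.Flat S S)
  | i + 1 => by
    have : Module.Free S ((Fin q → S) [⋀^Fin (e + i + 1)]→ₗ[S] S) :=
      Module.Free.of_equiv (exteriorPower.alternatingMapLinearEquiv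
        (R := S) (M := Fin q → S) (N := S) (n := e + i + 1)).symm
    exact inferInstanceAs
      (Module.Flat S (Sym (Fin (e + 1)) i → (Fin q → S) [⋀^Fin (e + i + 1)]→ₗ[S] S))

theorem subsingleton_alternatingMap {n : ℕ} (h : q < n) :
    Subsingleton ((Fin q → S) [⋀^Fin n]→ₗ[S] S) := by
  refine ⟨fun f g => (Pi.basisFun S (Fin q)).ext_alternating fun v hv => ?_⟩
  have := Fintype.card_le_of_injective v hv
  simp at this
  omega

theorem subsingleton_term {i : ℕ} (h : q - e < i) : Subsingleton (Term S q e i) := by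
  obtain ⟨i, rfl⟩ := Nat.exists_eq_add_of_lt (Nat.zero_lt_of_lt h)
  rw [zero_add]
  have : Subsingleton ((Fin q → S) [⋀^Fin (e + i + 1)]→ₗ[S] S) :=
    subsingleton_alternatingMap (by omega)
  exact inferInstanceAs
    (Subsingleton (Sym (Fin (e + 1)) i → (Fin q → S) [⋀^Fin (e + i + 1)]→ₗ[S] S))

/-- The differentials of the Eagon–Northcott complex. -/
def termDiff (Ψ : Fin (e + 1) → Fin q → S) : ∀ i, Term S q e (i + 1) →ₗ[S] Term S q e i
  | 0 =>
    { toFun := fun f : Sym (Fin (e + 1)) 0 → (Fin q → S) [⋀^Fin (e + 1)]→ₗ[S] S => f Sym.nil Ψ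
      map_add' := fun _ _ => rfl
      map_smul' := fun _ _ => rfl }
  | i + 1 => restrict S i ∘ₗ diff Ψ (n := e + i + 1) ∘ₗ extend S (i + 1)

theorem diff_extend_of_ne (Ψ : Fin (e + 1) → Fin q → S) {i n : ℕ}
    (f : Sym (Fin (e + 1)) (i + 1) → (Fin q → S) [⋀^Fin (n + 1)]→ₗ[S] S)
    {a : Multiset (Fin (e + 1))} (h : a.card ≠ i) : diff Ψ (extend S (i + 1) f) a = 0 := by
  rw [diff_apply, Finset.sum_eq_zero]
  intro k _
  rw [extend_of_ne, _root_.map_zero]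
  simpa using h

theorem extend_termDiff (Ψ : Fin (e + 1) → Fin q → S) (i : ℕ)
    (f : Sym (Fin (e + 1)) (i + 1) → (Fin q → S) [⋀^Fin (e + i + 2)]→ₗ[S] S) :
    extend S i (restrict S i (diff Ψ (extend S (i + 1) f))) = diff Ψ (extend S (i + 1) f) :=
  extend_restrict _ _ fun _ => diff_extend_of_ne Ψ f

theorem diff_apply_self (Ψ : Fin (e + 1) → Fin q → S)
    (f : Multiset (Fin (e + 1)) → (Fin q → S) [⋀^Fin (e + 2)]→ₗ[S] S)
    (a : Multiset (Fin (e + 1))) : diff Ψ f a Ψ = 0 := by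
  rw [diff_apply]
  rw [show ((∑ k, contract (Ψ k) (f (k ::ₘ a))) Ψ) = ∑ k, contract (Ψ k) (f (k ::ₘ a)) Ψ from
    map_sum (AddMonoidHom.mk' (fun f : (Fin q → S) [⋀^Fin (e + 1)]→ₗ[S] S => f Ψ)
      fun _ _ => rfl) _ _]
  refine Finset.sum_eq_zero fun k _ => ?_
  rw [contract_apply]
  exact AlternatingMap.map_eq_zero_of_eq _ _ (i := 0) (j := k.succ) (by simp)
    (Fin.succ_ne_zero k).symm

theorem restrict_diff_restrict (Ψ : Fin (e + 1) → Fin q → S) {i n : ℕ}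
    (g : Multiset (Fin (e + 1)) → (Fin q → S) [⋀^Fin (n + 1)]→ₗ[S] S) :
    restrict S i (diff Ψ (extend S (i + 1) (restrict S (i + 1) g))) = restrict S i (diff Ψ g) := by
  funext a
  change diff Ψ _ a.1 = diff Ψ g a.1
  simp only [diff_apply]
  refine Finset.sum_congr rfl fun k _ => ?_
  congr 1
  exact dif_pos (by simp)

theorem termDiff_termDiff (Ψ : Fin (e + 1) → Fin q → S) :
    ∀ i x, termDiff Ψ i (termDiff Ψ (i + 1) x) = 0
  | 0, x => diff_apply_self Ψ _ _
  | i + 1, x => by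
    refine (restrict_diff_restrict Ψ (n := e + i + 1) (i := i)
      (diff Ψ (n := e + i + 2) (extend S (i + 2) x))).trans ?_
    rw [diff_diff]
    rfl

/-- The linear forms dual to the rows of the matrix, up to the factor `lam Ψ`. -/
def dualForm (Ψ : Fin (e + 1) → Fin q → S) (lam : (Fin q → S) [⋀^Fin (e + 1)]→ₗ[S] S)
    (k : Fin (e + 1)) : (Fin q → S) →ₗ[S] S := lam.toMultilinearMap.toLinearMap Ψ k

theorem dualForm_apply (Ψ : Fin (e + 1) → Fin q → S) (lam : (Fin q → S) [⋀^Fin (e + 1)]→ₗ[S] S)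
    (j k : Fin (e + 1)) : dualForm Ψ lam k (Ψ j) = if j = k then lam Ψ else 0 := by
  change lam (Function.update Ψ k (Ψ j)) = _
  split_ifs with h
  · rw [h, Function.update_eq_self]
  · exact lam.map_update_self Ψ (Ne.symm h)

theorem exists_termDiff_eq_smul (Ψ : Fin (e + 1) → Fin q → S)
    (lam : (Fin q → S) [⋀^Fin (e + 1)]→ₗ[S] S) :
    ∀ i x, termDiff Ψ i x = 0 →
      ∃ z, termDiff Ψ (i + 1) z = lam Ψ ^ (2 * (e + 1)) • x
  | 0, x, hx => by
    change Sym (Fin (e + 1)) 0 → (Fin q → S) [⋀^Fin (e + 1)]→ₗ[S] S at x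
    have h0 : diff Ψ (extend S 0 x) = 0 := by
      funext a
      rw [diff_apply, Finset.sum_eq_zero]
      · rfl
      intro k _
      rw [extend_of_ne _ (by simp), _root_.map_zero]
    obtain ⟨g, r, h1, -, -, h4, h5⟩ := exists_diff_of_cycle Ψ (dualForm Ψ lam)
      (dualForm_apply Ψ lam) (n := e) (extend S 0 x) h0 (Finset.univ.toList)
    have hr : lam Ψ ^ (e + 1) • r = 0 := by
      funext a
      rcases Multiset.empty_or_exists_mem a with rfl | ⟨k, hk⟩
      · refine pow_smul_eq_zero_of_proj (dualForm Ψ lam) Ψ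
          (fun j k hjk => by rw [dualForm_apply, if_neg hjk]) (r 0) (fun k => h5 k (by simp)) ?_
        have := congrArg (fun f => f 0 Ψ) h1
        simp only [Pi.add_apply, AlternatingMap.add_apply, diff_apply_self, zero_add] at this
        rw [← this]
        change lam Ψ ^ (Finset.univ : Finset (Fin (e + 1))).toList.length • (x Sym.nil Ψ) = 0
        rw [show x Sym.nil Ψ = 0 from hx, smul_zero]
      · rw [Pi.smul_apply, h4 a k (by simp) hk, smul_zero]
        rfl
    refine ⟨restrict S 1 (lam Ψ ^ (e + 1) • g), ?_⟩
    refine (restrict_diff_restrict Ψ (n := e + 1) (i := 0) _).trans ?_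
    rw [map_smul, eq_sub_of_add_eq h1.symm, smul_sub, hr, sub_zero, ← mul_smul, map_smul,
      restrict_extend]
    simp [two_mul, pow_add]
    rfl
  | i + 1, x, hx => by
    change Sym (Fin (e + 1)) (i + 1) → (Fin q → S) [⋀^Fin (e + i + 2)]→ₗ[S] S at x
    have h0 : diff Ψ (extend S (i + 1) x) = 0 := by
      rw [← extend_termDiff]
      exact (congrArg (extend S i) hx).trans (LinearMap.map_zero _)
    obtain ⟨g, r, h1, -, h3, h4, -⟩ := exists_diff_of_cycle Ψ (dualForm Ψ lam)
      (dualForm_apply Ψ lam) (n := e + i + 1) (extend S (i + 1) x) h0 (Finset.univ.toList)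
    have hr : r = 0 := by
      funext a
      rcases Multiset.empty_or_exists_mem a with rfl | ⟨k, hk⟩
      · exact h3 0 (extend_of_ne _ (by simp))
      · exact h4 a k (by simp) hk
    rw [hr, add_zero] at h1
    refine ⟨restrict S (i + 2) (lam Ψ ^ (e + 1) • g), ?_⟩
    refine (restrict_diff_restrict Ψ (n := e + i + 2) (i := i + 1) _).trans ?_
    rw [map_smul, ← h1, ← mul_smul, map_smul, restrict_extend]
    simp [two_mul, pow_add]
    rfl

theorem mem_of_mul_mem (Ψ : Fin (e + 1) → Fin q → S) (ys xs : List S)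
    (hys : IsWeaklyRegular S ys) (hxs : IsWeaklyRegular S xs) (hly : ys.length = q - e)
    (hlx : xs.length = q - e + 1)
    (hy : ∀ y ∈ ys, y ∈ Ideal.span (Set.range fun lam : (Fin q → S) [⋀^Fin (e + 1)]→ₗ[S] S =>
      lam Ψ ^ (2 * (e + 1))))
    (u : S) (hu : ∀ x ∈ xs, ∃ lam : (Fin q → S) [⋀^Fin (e + 1)]→ₗ[S] S, lam Ψ = x * u) :
    ∃ lam : (Fin q → S) [⋀^Fin (e + 1)]→ₗ[S] S, lam Ψ = u := by
  have hex := exact_of_smul_exact ys (Term S q e) (termDiff Ψ) (termDiff_termDiff Ψ)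
    (fun y hy' i x hx => by
      have hle : Ideal.span (Set.range fun lam : (Fin q → S) [⋀^Fin (e + 1)]→ₗ[S] S =>
          lam Ψ ^ (2 * (e + 1))) ≤ (LinearMap.range (termDiff Ψ (i + 1))).comap
            (LinearMap.toSpanSingleton S _ x) := by
        rw [Ideal.span_le]
        rintro _ ⟨lam, rfl⟩
        exact exists_termDiff_eq_smul Ψ lam i x hx
      exact hle (hy y hy'))
    (fun i hi => subsingleton_term (by omega)) (fun i => hys.of_flat_module)
  obtain ⟨w, hw⟩ := exists_of_smul_mem_range_of_exact xs (Term S q e) (termDiff Ψ)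
    (termDiff_termDiff Ψ) hex (fun i hi => subsingleton_term (by omega))
    (fun i => hxs.of_flat_module) u (fun x hx => by
      obtain ⟨lam, hl⟩ := hu x hx
      exact ⟨fun _ => lam, hl⟩)
  exact ⟨w Sym.nil, hw⟩

end EagonNorthcott

open RingTheory.Sequence IsLocalRing CategoryTheory Abelian in
theorem IsLocalRing.exists_isRegular_quotSMulTop {A : Type u} [CommRing A] [IsLocalRing A]
    [IsNoetherianRing A] (M : Type u) [AddCommGroup M] [Module A M] [Module.Finite A M]
    {y : A} (hy : y ∈ maximalIdeal A) (hreg : IsSMulRegular M y) {n : ℕ} (xs : List A)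
    (hlen : xs.length = n + 1) (hmem : ∀ x ∈ xs, x ∈ maximalIdeal A) (hxs : IsRegular M xs) :
    ∃ rs : List A, rs.length = n ∧ (∀ x ∈ rs, x ∈ maximalIdeal A) ∧
      IsRegular (QuotSMulTop y M) rs := by
  have : Nontrivial M := hxs.nontrivial
  have hlt : ∀ (M' : Type u) [AddCommGroup M'] [Module A M'] [Module.Finite A M'] [Nontrivial M'],
      maximalIdeal A • (⊤ : Submodule A M') < ⊤ := fun M' _ _ _ _ =>
    (Submodule.top_ne_ideal_smul_of_le_jacobson_annihilator
      (maximalIdeal_le_jacobson _)).symm.lt_top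
  have hsupp : Module.support A (A ⧸ maximalIdeal A) =
      PrimeSpectrum.zeroLocus (maximalIdeal A : Set A) := by
    rw [Module.support_eq_zeroLocus, Ideal.annihilator_quotient]
  have : Nontrivial (QuotSMulTop y M) := nontrivial_quotSMulTop_of_mem_maximalIdeal M hy
  have hext := ModuleCat.subsingleton_ext_of_exists_isRegular (maximalIdeal A)
    (ModuleCat.of A (A ⧸ maximalIdeal A)) hsupp.le (ModuleCat.of A M) (hlt M) xs hmem hxs
  refine ModuleCat.exists_isRegular_of_exists_subsingleton_ext (maximalIdeal A) n
    (ModuleCat.of A (QuotSMulTop y M)) (hlt _) (ModuleCat.of A (A ⧸ maximalIdeal A)) hsupp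
    fun i hi => ?_
  have hreg' : IsSMulRegular (ModuleCat.of A M) y := hreg
  have zero1 := AddCommGrpCat.isZero_of_iff_subsingleton.mpr (hext i (by omega))
  have zero2 := AddCommGrpCat.isZero_of_iff_subsingleton.mpr (hext (i + 1) (by omega))
  exact AddCommGrpCat.subsingleton_of_isZero <| ShortComplex.Exact.isZero_of_both_zeros
    ((Ext.covariant_sequence_exact₃' (ModuleCat.of A (A ⧸ maximalIdeal A))
      hreg'.smulShortComplex_shortExact) i (i + 1) rfl)
    (zero1.eq_zero_of_src _) (zero2.eq_zero_of_tgt _)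

open RingTheory.Sequence IsLocalRing Pointwise in
/-- The maximal ideal is not associated to the quotient by a weakly regular sequence which is
shorter than another one. -/
theorem IsLocalRing.mem_ofList_smul_top_of_isWeaklyRegular {A : Type u} [CommRing A]
    [IsLocalRing A] [IsNoetherianRing A] (rs : List A) :
    ∀ (M : Type u) [AddCommGroup M] [Module A M] [Module.Finite A M] (xs : List A)
      (_ : ∀ x ∈ rs, x ∈ maximalIdeal A) (_ : IsWeaklyRegular M rs)
      (_ : xs.length = rs.length + 1) (_ : ∀ x ∈ xs, x ∈ maximalIdeal A)
      (_ : IsWeaklyRegular M xs) (w : M)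
      (_ : ∀ x ∈ maximalIdeal A, x • w ∈ Ideal.ofList rs • (⊤ : Submodule A M)),
      w ∈ Ideal.ofList rs • (⊤ : Submodule A M) := by
  induction rs with
  | nil =>
    intro M _ _ _ xs _ _ hlen hmem hxs w hw
    obtain ⟨x, rfl⟩ := List.length_eq_one_iff.1 hlen
    have h := hw x (hmem x (by simp))
    rw [isWeaklyRegular_singleton_iff] at hxs
    simp only [Ideal.ofList_nil, Submodule.bot_smul, Submodule.mem_bot] at h ⊢
    exact hxs.right_eq_zero_of_smul h
  | cons y rs ih =>
    intro M _ _ _ xs hrm hr hlen hmem hxs w hw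
    rcases subsingleton_or_nontrivial M with hM | hM
    · rw [Subsingleton.elim w 0]
      exact zero_mem _
    have hxr := IsRegular.of_isWeaklyRegular_of_mem_maximalIdeal M hmem hxs
    rw [isWeaklyRegular_cons_iff] at hr
    obtain ⟨xs', hlen', hmem', hxs'⟩ := exists_isRegular_quotSMulTop M (hrm y (by simp)) hr.1
      xs (by simpa using hlen) hmem hxr
    have hcomap : Ideal.ofList (y :: rs) • (⊤ : Submodule A M) =
        (Ideal.ofList rs • (⊤ : Submodule A (QuotSMulTop y M))).comap
          (Submodule.mkQ (y • (⊤ : Submodule A M))) := by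
      rw [Submodule.comap_smul_top_of_surjective _ _ (Submodule.mkQ_surjective _),
        Submodule.ker_mkQ, Ideal.ofList_cons_smul, sup_comm]
    rw [hcomap] at hw ⊢
    exact ih (QuotSMulTop y M) xs' (fun x hx => hrm x (by simp [hx])) hr.2 hlen' hmem'
      hxs'.toIsWeaklyRegular _ fun x hx => by
        have := hw x hx
        rwa [Submodule.mem_comap, map_smul] at this

open RingTheory.Sequence IsLocalRing in
theorem IsRegularLocalRing.exists_isWeaklyRegular_of_le {A : Type*} [CommRing A]
    [IsRegularLocalRing A] {n : ℕ} (hn : (n : WithBot ℕ∞) ≤ ringKrullDim A) :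
    ∃ rs : List A, rs.length = n ∧ (∀ x ∈ rs, x ∈ maximalIdeal A) ∧ IsWeaklyRegular A rs := by
  obtain ⟨N, hN⟩ : ∃ N : ℕ, ringKrullDim A = N :=
    ⟨_, (IsRegularLocalRing.spanFinrank_maximalIdeal (R := A)).symm⟩
  obtain ⟨-, rs, hlen, hmem, hrs⟩ := isDomain_and_exists_isWeaklyRegular N A hN
  rw [hN] at hn
  have hn' : n ≤ N := by exact_mod_cast hn
  refine ⟨rs.take n, by simp [hlen, hn'], fun x hx => hmem x (List.mem_of_mem_take hx), ?_⟩
  rw [← List.take_append_drop n rs, isWeaklyRegular_append_iff] at hrs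
  exact hrs.1

open RingTheory.Sequence IsLocalRing in
theorem IsRegularRing.exists_isWeaklyRegular {S : Type u} [CommRing S] [IsRegularRing S]
    (I : Ideal S) (n : ℕ) (hI : ∀ Q : Ideal S, Q.IsPrime → I ≤ Q → (n : ℕ∞) ≤ Q.height) :
    ∃ rs : List S, rs.length = n ∧ (∀ x ∈ rs, x ∈ I) ∧ IsWeaklyRegular S rs := by
  induction n with
  | zero => exact ⟨[], rfl, by simp, by simp⟩
  | succ n ih =>
    obtain ⟨rs, hlen, hmem, hrs⟩ := ih fun Q hQ hIQ =>
      le_trans (by exact_mod_cast n.le_succ) (hI Q hQ hIQ)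
    suffices h : ∃ z ∈ I, IsSMulRegular (S ⧸ (Ideal.ofList rs • ⊤ : Submodule S S)) z by
      obtain ⟨z, hz, hreg⟩ := h
      refine ⟨rs ++ [z], by simp [hlen], ?_, ?_⟩
      · simp only [List.mem_append, List.mem_singleton]
        rintro x (hx | rfl)
        exacts [hmem x hx, hz]
      · rw [isWeaklyRegular_append_iff, isWeaklyRegular_singleton_iff]
        exact ⟨hrs, hreg⟩
    by_contra! hcon
    obtain ⟨Q, hQ, hIQ⟩ : ∃ Q ∈ associatedPrimes S (S ⧸ (Ideal.ofList rs • ⊤ : Submodule S S)),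
        I ≤ Q := by
      apply (Ideal.subset_union_prime_finite
        (associatedPrimes.finite S (S ⧸ (Ideal.ofList rs • ⊤ : Submodule S S))) ⊥ ⊥ _).mp
      · rw [biUnion_associatedPrimes_eq_compl_regular]
        exact fun r hr ↦ hcon r hr
      · exact fun _ hin _ _ ↦ IsAssociatedPrime.isPrime hin
    obtain ⟨hQp, x, hx⟩ := isAssociatedPrime_iff.1 hQ
    obtain ⟨w, rfl⟩ := Submodule.Quotient.mk_surjective _ x
    have hQw : ∀ r, r ∈ Q ↔ r * w ∈ Ideal.ofList rs := fun r => by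
      rw [hx, Submodule.mem_colon_singleton, Submodule.mem_bot, ← Submodule.Quotient.mk_smul,
        Submodule.Quotient.mk_eq_zero, smul_eq_mul, smul_eq_mul, Ideal.mul_top]
    let A := Localization.AtPrime Q
    have hdim : ((n + 1 : ℕ) : WithBot ℕ∞) ≤ ringKrullDim A := by
      rw [IsLocalization.AtPrime.ringKrullDim_eq_height Q A]
      exact_mod_cast hI Q hQp hIQ
    obtain ⟨xs, hxlen, hxmem, hxs⟩ := IsRegularLocalRing.exists_isWeaklyRegular_of_le hdim
    have hmax : maximalIdeal A = Q.map (algebraMap S A) :=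
      (Localization.AtPrime.map_eq_maximalIdeal).symm
    have := mem_ofList_smul_top_of_isWeaklyRegular (rs.map (algebraMap S A)) A xs
      (fun x hx => by
        obtain ⟨y, hy, rfl⟩ := List.mem_map.1 hx
        rw [hmax]
        exact Ideal.mem_map_of_mem _ (hIQ (hmem y hy)))
      (hrs.of_isLocalization A Q.primeCompl) (by simp [hxlen, hlen]) hxmem hxs
      (algebraMap S A w) (fun x hx => by
        rw [smul_eq_mul, smul_eq_mul, Ideal.mul_top, ← Ideal.map_ofList]
        rw [hmax] at hx
        have : x ∈ ((Ideal.ofList rs).map (algebraMap S A)).colon {algebraMap S A w} := by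
          refine (Ideal.map_le_iff_le_comap.2 fun r hr => ?_) hx
          rw [Ideal.mem_comap, Submodule.mem_colon_singleton, smul_eq_mul, ← map_mul]
          exact Ideal.mem_map_of_mem _ ((hQw r).1 hr)
        rwa [Submodule.mem_colon_singleton] at this)
    rw [smul_eq_mul, Ideal.mul_top, ← Ideal.map_ofList,
      IsLocalization.algebraMap_mem_map_algebraMap_iff Q.primeCompl] at this
    obtain ⟨s, hs, hsw⟩ := this
    exact hs ((hQw s).2 hsw)

namespace EagonNorthcott

/-- The ideal of values of alternating forms on the rows of `Ψ`, that is, the ideal of maximal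
minors of `Ψ`. -/
def valueIdeal {S : Type*} [CommRing S] {q e : ℕ} (Ψ : Fin (e + 1) → Fin q → S) : Ideal S :=
  LinearMap.range (({ toFun := fun lam => lam Ψ
                      map_add' := fun _ _ => rfl
                      map_smul' := fun _ _ => rfl } :
    ((Fin q → S) [⋀^Fin (e + 1)]→ₗ[S] S) →ₗ[S] S))

theorem mem_valueIdeal {S : Type*} [CommRing S] {q e : ℕ} {Ψ : Fin (e + 1) → Fin q → S} {x : S} :
    x ∈ valueIdeal Ψ ↔ ∃ lam : (Fin q → S) [⋀^Fin (e + 1)]→ₗ[S] S, lam Ψ = x := Iff.rfl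

/-- Unmixedness of the ideal of maximal minors of generic height in a regular ring. -/
theorem mem_valueIdeal_of_height {S : Type u} [CommRing S] [IsRegularRing S] {q e : ℕ}
    (Ψ : Fin (e + 1) → Fin q → S)
    (hΨ : ∀ P : Ideal S, P.IsPrime → valueIdeal Ψ ≤ P → ((q - e : ℕ) : ℕ∞) ≤ P.height)
    (Q : Ideal S) [Q.IsPrime] (hQ : ((q - e + 1 : ℕ) : ℕ∞) ≤ Q.height) (u : S)
    (hu : ∀ x ∈ Q, x * u ∈ valueIdeal Ψ) : u ∈ valueIdeal Ψ := by
  obtain ⟨ys, hly, hys, hyr⟩ := IsRegularRing.exists_isWeaklyRegular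
    (Ideal.span (Set.range fun lam : (Fin q → S) [⋀^Fin (e + 1)]→ₗ[S] S =>
      lam Ψ ^ (2 * (e + 1)))) (q - e) fun P hP hle => hΨ P hP <| by
        rintro _ ⟨lam, rfl⟩
        exact hP.mem_of_pow_mem _ (hle (Ideal.subset_span ⟨lam, rfl⟩))
  obtain ⟨xs, hlx, hxs, hxr⟩ := IsRegularRing.exists_isWeaklyRegular Q (q - e + 1)
    fun P _ hle => hQ.trans (Ideal.height_mono hle)
  exact mem_of_mul_mem Ψ ys xs hyr hxr hly hlx hys u fun x hx => hu x (hxs x hx)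

end EagonNorthcott

namespace MvPolynomial

/-- The linear form with given coefficient vector. -/
noncomputable def linForm {A : Type*} [CommRing A] {d : ℕ} :
    (Fin d → A) →ₗ[A] MvPolynomial (Fin d) A :=
  Fintype.linearCombination A (fun i => (X i : MvPolynomial (Fin d) A))

section CommRing

variable {A B : Type*} [CommRing A] [CommRing B] {d : ℕ}

theorem linForm_apply (u : Fin d → A) : linForm u = ∑ i, C (u i) * X i := by
  simp [linForm, Fintype.linearCombination_apply, MvPolynomial.smul_eq_C_mul]

theorem coeff_linForm (u : Fin d → A) (i : Fin d) :
    coeff (Finsupp.single i 1) (linForm u) = u i := by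
  classical
  simp [linForm_apply, coeff_sum, coeff_C_mul, coeff_X, Finsupp.single_left_inj]

theorem linForm_injective : Function.Injective (linForm : (Fin d → A) → _) := fun u v h => by
  funext i
  rw [← coeff_linForm u, h, coeff_linForm]

theorem linForm_single (i : Fin d) : linForm (Pi.single i (1 : A)) = X i := by
  simp [linForm]

theorem map_linForm (f : A →+* B) (u : Fin d → A) :
    map f (linForm u) = linForm (fun i => f (u i)) := by
  simp [linForm_apply]

theorem aeval_linForm (π : (Fin d → A) →ₗ[A] (Fin d → A)) (u : Fin d → A) :
    aeval (fun i => linForm (π (Pi.single i 1))) (linForm u) = linForm (π u) := by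
  have h : (aeval (fun i => linForm (π (Pi.single i 1))) :
      MvPolynomial (Fin d) A →ₐ[A] MvPolynomial (Fin d) A).toLinearMap ∘ₗ linForm =
      linForm ∘ₗ π := by
    ext i : 2
    simp [linForm_single]
  exact LinearMap.congr_fun h u

end CommRing

section Field

variable {κ : Type*} [Field κ] {d : ℕ}

/-- The ideal of a linear subspace of linear forms. -/
noncomputable def linIdeal (W : Submodule κ (Fin d → κ)) : Ideal (MvPolynomial (Fin d) κ) :=
  Ideal.span (linForm '' W)

theorem exists_ker_eq_linIdeal (W : Submodule κ (Fin d → κ)) :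
    ∃ (π : (Fin d → κ) →ₗ[κ] (Fin d → κ)), LinearMap.ker π = W ∧
      RingHom.ker (aeval (fun i => linForm (π (Pi.single i 1))) :
        MvPolynomial (Fin d) κ →ₐ[κ] MvPolynomial (Fin d) κ) = linIdeal W := by
  obtain ⟨W', hW⟩ := W.exists_isCompl
  have hπ := Submodule.ker_projection hW.symm
  set π := W'.projection W hW.symm
  refine ⟨π, hπ, le_antisymm (fun p hp => ?_) ?_⟩
  · have h : (Ideal.Quotient.mkₐ κ (linIdeal W)).comp (aeval (fun i => linForm (π (Pi.single i 1))))
        = Ideal.Quotient.mkₐ κ (linIdeal W) := by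
      ext i
      simp only [AlgHom.comp_apply, aeval_X, Ideal.Quotient.mkₐ_eq_mk]
      refine (Ideal.Quotient.mk_eq_mk_iff_sub_mem _ _).2 ?_
      rw [← neg_mem_iff, neg_sub, ← linForm_single, ← map_sub]
      exact Ideal.subset_span ⟨_, Submodule.sub_projection_mem hW.symm _, rfl⟩
    have h2 := AlgHom.congr_fun h p
    rw [AlgHom.comp_apply, show aeval _ p = _ from hp, map_zero] at h2
    exact Ideal.Quotient.eq_zero_iff_mem.1 h2.symm
  · rw [linIdeal, Ideal.span_le]
    rintro _ ⟨w, hw, rfl⟩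
    rw [SetLike.mem_coe, RingHom.mem_ker]
    refine (aeval_linForm π w).trans ?_
    rw [LinearMap.mem_ker.1 (hπ.ge hw), map_zero]

theorem linIdeal_isPrime (W : Submodule κ (Fin d → κ)) : (linIdeal W).IsPrime := by
  obtain ⟨π, -, h⟩ := exists_ker_eq_linIdeal W
  rw [← h]
  exact RingHom.ker_isPrime _

theorem linForm_mem_linIdeal {W : Submodule κ (Fin d → κ)} {w : Fin d → κ} :
    linForm w ∈ linIdeal W ↔ w ∈ W := by
  obtain ⟨π, hπ, h⟩ := exists_ker_eq_linIdeal W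
  rw [← h, RingHom.mem_ker, ← hπ, LinearMap.mem_ker, ← linForm_injective.eq_iff, map_zero]
  exact Eq.congr_left (aeval_linForm π w)

end Field

end MvPolynomial

namespace MvPolynomial

theorem _root_.Ideal.algebraMap_fractionRing_eq_zero_iff {R : Type*} [CommRing R] (P : Ideal R)
    (r : R) : algebraMap R (FractionRing (R ⧸ P)) r = 0 ↔ r ∈ P := by
  rw [IsScalarTower.algebraMap_apply R (R ⧸ P), FaithfulSMul.algebraMap_eq_zero_iff,
    Ideal.Quotient.algebraMap_eq, Ideal.Quotient.eq_zero_iff_mem]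

variable {R : Type*} [CommRing R] {d : ℕ} (P : Ideal R) [P.IsPrime]

/-- Every vector over the residue field is, up to a scalar, the image of a vector. -/
theorem _root_.Ideal.exists_smul_eq_algebraMap_fractionRing (w : Fin d → FractionRing (R ⧸ P)) :
    ∃ s ∉ P, ∃ v : Fin d → R, ∀ i, algebraMap R (FractionRing (R ⧸ P)) (v i) =
      algebraMap R (FractionRing (R ⧸ P)) s * w i := by
  obtain ⟨⟨s, hs⟩, h⟩ := IsLocalization.exist_integer_multiples_of_finite
    (nonZeroDivisors (R ⧸ P)) w
  choose v hv using h
  obtain ⟨s, rfl⟩ := Ideal.Quotient.mk_surjective s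
  choose v' hv' using fun i => Ideal.Quotient.mk_surjective (v i)
  refine ⟨s, fun h => ?_, v', fun i => ?_⟩
  · exact nonZeroDivisors.ne_zero hs (Ideal.Quotient.eq_zero_iff_mem.2 h)
  · rw [IsScalarTower.algebraMap_apply R (R ⧸ P), Ideal.Quotient.algebraMap_eq, hv', hv,
      IsScalarTower.algebraMap_apply R (R ⧸ P), Ideal.Quotient.algebraMap_eq, Algebra.smul_def]

/-- The prime ideal of polynomials whose image over the residue field at `P` lies in the ideal of
a linear subspace. -/
noncomputable def fiberIdeal (W : Submodule (FractionRing (R ⧸ P)) (Fin d → FractionRing (R ⧸ P))) :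
    Ideal (MvPolynomial (Fin d) R) :=
  (linIdeal W).comap (map (algebraMap R (FractionRing (R ⧸ P))))

variable {P} {W : Submodule (FractionRing (R ⧸ P)) (Fin d → FractionRing (R ⧸ P))}

instance : (fiberIdeal P W).IsPrime :=
  have := linIdeal_isPrime W
  Ideal.comap_isPrime _ _

theorem C_mem_fiberIdeal {r : R} : C r ∈ fiberIdeal P W ↔ r ∈ P := by
  have := linIdeal_isPrime W
  rw [fiberIdeal, Ideal.mem_comap, map_C, ← Ideal.algebraMap_fractionRing_eq_zero_iff P r]
  refine ⟨fun h => ?_, fun h => by rw [h, C_0]; exact zero_mem _⟩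
  by_contra hr
  exact this.ne_top (Ideal.eq_top_of_isUnit_mem _ h ((isUnit_iff_ne_zero.2 hr).map C))

theorem linForm_mem_fiberIdeal {u : Fin d → R} : linForm u ∈ fiberIdeal P W ↔
    (fun i => algebraMap R (FractionRing (R ⧸ P)) (u i)) ∈ W := by
  rw [fiberIdeal, Ideal.mem_comap, map_linForm, linForm_mem_linIdeal]

instance : (fiberIdeal P W).LiesOver P :=
  ⟨by ext r; exact C_mem_fiberIdeal.symm⟩

/-- The span over the residue field of the image of a set of vectors. -/
def residueSpan (P : Ideal R) [P.IsPrime] (U : Set (Fin d → R)) :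
    Submodule (FractionRing (R ⧸ P)) (Fin d → FractionRing (R ⧸ P)) :=
  Submodule.span _ ((fun u i => algebraMap R (FractionRing (R ⧸ P)) (u i)) '' U)

theorem exists_mul_mem_of_mem_fiberIdeal {U : Set (Fin d → R)} {x : MvPolynomial (Fin d) R}
    (hx : x ∈ fiberIdeal P (residueSpan P U)) :
    ∃ s ∉ P, C s * x ∈ P.map C ⊔ Ideal.span (linForm '' U) := by
  let : Algebra (MvPolynomial (Fin d) (R ⧸ P)) (MvPolynomial (Fin d) (FractionRing (R ⧸ P))) :=
    algebraMvPolynomial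
  have h1 : map (algebraMap R (FractionRing (R ⧸ P))) x ∈
      ((Ideal.span (linForm '' U)).map (map (Ideal.Quotient.mk P))).map
        (algebraMap (MvPolynomial (Fin d) (R ⧸ P)) (MvPolynomial (Fin d) (FractionRing (R ⧸ P)))) := by
    refine (Ideal.span_le.2 ?_) hx
    rintro _ ⟨w, hw, rfl⟩
    refine Submodule.span_induction (p := fun w _ => linForm w ∈ _) ?_ ?_ ?_ ?_ hw
    · rintro _ ⟨u, hu, rfl⟩
      have : linForm (fun i => algebraMap R (FractionRing (R ⧸ P)) (u i)) =
          algebraMap (MvPolynomial (Fin d) (R ⧸ P)) (MvPolynomial (Fin d) (FractionRing (R ⧸ P)))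
            (map (Ideal.Quotient.mk P) (linForm u)) := by
        rw [algebraMap_def, map_map, map_linForm]
        rfl
      rw [this]
      exact Ideal.mem_map_of_mem _ (Ideal.mem_map_of_mem _ (Ideal.subset_span ⟨u, hu, rfl⟩))
    · rw [map_zero]; exact zero_mem _
    · intro a b _ _ ha hb
      rw [map_add]; exact add_mem ha hb
    · intro c a _ ha
      rw [map_smul, smul_eq_C_mul]; exact Ideal.mul_mem_left _ _ ha
  have h2 : map (algebraMap R (FractionRing (R ⧸ P))) x =
      algebraMap (MvPolynomial (Fin d) (R ⧸ P)) (MvPolynomial (Fin d) (FractionRing (R ⧸ P)))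
        (map (Ideal.Quotient.mk P) x) := by
    rw [algebraMap_def, map_map]; rfl
  rw [h2, IsLocalization.algebraMap_mem_map_algebraMap_iff
    ((nonZeroDivisors (R ⧸ P)).map (C (σ := Fin d)))] at h1
  obtain ⟨_, ⟨s, hs, rfl⟩, h⟩ := h1
  obtain ⟨s, rfl⟩ := Ideal.Quotient.mk_surjective s
  refine ⟨s, fun h => nonZeroDivisors.ne_zero hs (Ideal.Quotient.eq_zero_iff_mem.2 h), ?_⟩
  rw [← map_C (Ideal.Quotient.mk P), ← map_mul, Ideal.mem_map_iff_of_surjective _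
    (map_surjective _ Ideal.Quotient.mk_surjective)] at h
  obtain ⟨y, hy, hyx⟩ := h
  rw [← sub_add_cancel (C s * x) y]
  refine Ideal.add_mem _ (Ideal.mem_sup_left ?_) (Ideal.mem_sup_right hy)
  rw [← Ideal.mk_ker (I := P), ← ker_map, RingHom.mem_ker, map_sub, hyx, sub_self]

theorem fiberIdeal_le {U : Set (Fin d → R)} {Q : Ideal (MvPolynomial (Fin d) R)} [Q.IsPrime]
    (hQ : Q.comap C = P) (hU : ∀ u ∈ U, linForm u ∈ Q) :
    fiberIdeal P (residueSpan P U) ≤ Q := by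
  intro x hx
  obtain ⟨s, hs, h⟩ := exists_mul_mem_of_mem_fiberIdeal hx
  have hle : P.map C ⊔ Ideal.span (linForm '' U) ≤ Q := by
    refine sup_le (Ideal.map_le_iff_le_comap.2 hQ.ge) (Ideal.span_le.2 ?_)
    rintro _ ⟨u, hu, rfl⟩
    exact hU u hu
  refine (Ideal.IsPrime.mem_or_mem ‹_› (hle h)).resolve_left fun h => hs ?_
  rwa [← hQ]

variable [IsNoetherianRing R]

theorem height_add_finrank_le_height_fiberIdeal
    (W : Submodule (FractionRing (R ⧸ P)) (Fin d → FractionRing (R ⧸ P))) :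
    P.height + Module.finrank (FractionRing (R ⧸ P)) W ≤ (fiberIdeal P W).height := by
  induction h : Module.finrank (FractionRing (R ⧸ P)) W generalizing W with
  | zero =>
    rw [Ideal.height_eq_height_add_of_liesOver_of_hasGoingDown P (fiberIdeal P W)]
    simp
  | succ n ih =>
    have hn : (Module.finBasisOfFinrankEq _ W h).coord 0 ≠ 0 := fun h0 => by
      simpa using LinearMap.congr_fun h0 (Module.finBasisOfFinrankEq _ W h 0)
    set f := (Module.finBasisOfFinrankEq _ W h).coord 0
    have hf := Module.Dual.finrank_ker_add_one_of_ne_zero hn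
    have h1 := ih ((LinearMap.ker f).map W.subtype)
      (by rw [LinearEquiv.finrank_eq ((Submodule.equivSubtypeMap W (LinearMap.ker f)).symm)]; omega)
    have hlt : fiberIdeal P ((LinearMap.ker f).map W.subtype) < fiberIdeal P W := by
      refine lt_of_le_not_ge (Ideal.comap_mono (Ideal.span_mono (Set.image_mono
        (Submodule.map_subtype_le _ _)))) fun hle => hn ?_
      ext w
      obtain ⟨s, hs, v, hv⟩ := Ideal.exists_smul_eq_algebraMap_fractionRing P w.1
      have hs0 := (Ideal.algebraMap_fractionRing_eq_zero_iff P s).not.2 hs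
      have hv' : (fun i => algebraMap R (FractionRing (R ⧸ P)) (v i)) =
          algebraMap R (FractionRing (R ⧸ P)) s • w.1 := _root_.funext hv
      have hmem := hle (linForm_mem_fiberIdeal.2 (hv' ▸ W.smul_mem _ w.2))
      rw [linForm_mem_fiberIdeal, hv', Submodule.smul_mem_iff _ hs0] at hmem
      obtain ⟨w', hw', hww⟩ := hmem
      rw [← Subtype.ext hww]
      exact hw'
    have := Ideal.height_add_one_le_of_lt_of_isPrime hlt
    refine le_trans ?_ this
    push_cast
    rw [← add_assoc]
    gcongr

theorem height_fiberIdeal_le {r : ℕ} (u : Fin r → Fin d → R) :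
    (fiberIdeal P (residueSpan P (Set.range u))).height ≤ P.height + r := by
  classical
  obtain ⟨s, hs, hcard⟩ := Ideal.exists_finset_card_eq_height_of_isNoetherianRing P
  have hmin : fiberIdeal P (residueSpan P (Set.range u)) ∈
      (Ideal.span ((s.image C ∪ Finset.univ.image (fun j => linForm (u j)) :
        Finset (MvPolynomial (Fin d) R)) : Set (MvPolynomial (Fin d) R))).minimalPrimes := by
    refine ⟨⟨inferInstance, Ideal.span_le.2 ?_⟩, fun Q ⟨hQ, hle⟩ hQW => ?_⟩
    · intro x hx
      simp only [Finset.coe_union, Finset.coe_image, Finset.coe_univ, Set.image_univ] at hx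
      rcases hx with ⟨r, hr, rfl⟩ | ⟨j, rfl⟩
      · exact C_mem_fiberIdeal.2 (hs.1.2 (Ideal.subset_span hr))
      · exact linForm_mem_fiberIdeal.2 (Submodule.subset_span ⟨_, ⟨j, rfl⟩, rfl⟩)
    · rw [Ideal.span_le] at hle
      simp only [Finset.coe_union, Finset.coe_image, Finset.coe_univ, Set.image_univ,
        Set.union_subset_iff] at hle
      have hQP : Q.comap C = P := by
        have h1 : Q.comap C ≤ P := fun r hr => C_mem_fiberIdeal.1 (hQW hr)
        refine le_antisymm h1 (hs.2 ⟨Ideal.comap_isPrime _ _, Ideal.span_le.2 fun r hr => ?_⟩ h1)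
        exact hle.1 ⟨r, hr, rfl⟩
      refine fiberIdeal_le hQP ?_
      rintro _ ⟨j, rfl⟩
      exact hle.2 ⟨j, rfl⟩
  have := Ideal.height_le_card_of_mem_minimalPrimes_span_finset hmin
  refine this.trans ?_
  rw [← hcard]
  have h1 := Finset.card_union_le (s.image C) (Finset.univ.image (fun j => linForm (u j)))
  have h2 := Finset.card_image_le (s := s) (f := (C : R →+* MvPolynomial (Fin d) R))
  have h3 := Finset.card_image_le (s := Finset.univ) (f := (fun j => linForm (u j)))
  rw [Finset.card_univ, Fintype.card_fin] at h3
  exact_mod_cast h1.trans (add_le_add h2 h3)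

end MvPolynomial

theorem Submodule.exists_sup_span_range_comp_eq_top {κ : Type*} [Field κ] {d : ℕ}
    (W : Submodule κ (Fin d → κ)) :
    ∃ g : Fin (d - Module.finrank κ W) → Fin d,
      W ⊔ Submodule.span κ (Set.range fun j => Pi.single (g j) (1 : κ)) = ⊤ := by
  have hfr : Module.finrank κ ((Fin d → κ) ⧸ W) = d - Module.finrank κ W := by
    have := W.finrank_quotient_add_finrank
    rw [Module.finrank_fin_fun] at this
    omega
  have htop : Submodule.span κ (Set.range fun i : Fin d => W.mkQ (Pi.single i 1)) = ⊤ := by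
    have := (Pi.basisFun κ (Fin d)).span_eq
    rw [Set.range_comp' W.mkQ, ← Submodule.map_span]
    rw [show (fun i : Fin d => (Pi.single i 1 : Fin d → κ)) = Pi.basisFun κ (Fin d) by ext1; simp,
      this, Submodule.map_top, Submodule.range_mkQ]
  obtain ⟨u, hu, hspan, -⟩ := Submodule.exists_fun_fin_finrank_span_eq κ
    (Set.range fun i : Fin d => W.mkQ (Pi.single i 1))
  choose g hg using hu
  have hr : d - Module.finrank κ W = Module.finrank κ
      (Submodule.span κ (Set.range fun i : Fin d => W.mkQ (Pi.single i 1))) := by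
    rw [htop, finrank_top, hfr]
  refine ⟨fun j => g (finCongr hr j), ?_⟩
  have hker := Submodule.comap_map_eq W.mkQ
    (Submodule.span κ (Set.range fun j => Pi.single (g (finCongr hr j)) (1 : κ)))
  rw [W.ker_mkQ] at hker
  rw [sup_comm, ← hker, Submodule.map_span, ← Set.range_comp]
  have : (W.mkQ ∘ fun j => Pi.single (g (finCongr hr j)) (1 : κ)) = u ∘ finCongr hr :=
    _root_.funext fun j => hg _
  rw [this, EquivLike.range_comp, hspan, htop, Submodule.comap_top]

namespace MvPolynomial

variable {R : Type*} [CommRing R] {d : ℕ} {P : Ideal R} [P.IsPrime]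

theorem le_finrank_residueSpan_add {U : Set (Fin d → R)} {c : ℕ} {s : Fin d → R}
    (hs : ∀ i, s i ∉ P)
    (a : Fin d → Fin c → R) (b : Fin c → Fin d → R)
    (h : ∀ i, s i • Pi.single i 1 - ∑ j, a i j • b j ∈ U) :
    d ≤ Module.finrank (FractionRing (R ⧸ P)) (residueSpan P U) + c := by
  set κ := FractionRing (R ⧸ P)
  let ι : (Fin d → R) → Fin d → κ := fun u i => algebraMap R κ (u i)
  have hs0 : ∀ i, algebraMap R κ (s i) ≠ 0 := fun i =>
    (Ideal.algebraMap_fractionRing_eq_zero_iff P (s i)).not.2 (hs i)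
  have htop : residueSpan P U ⊔ Submodule.span κ (Set.range fun j => ι (b j)) = ⊤ := by
    rw [eq_top_iff, ← (Pi.basisFun κ (Fin d)).span_eq, Submodule.span_le]
    rintro _ ⟨i, rfl⟩
    rw [SetLike.mem_coe, ← Submodule.smul_mem_iff _ (hs0 i)]
    have : algebraMap R κ (s i) • Pi.basisFun κ (Fin d) i =
        ι (s i • Pi.single i 1 - ∑ j, a i j • b j) + ∑ j, algebraMap R κ (a i j) • ι (b j) := by
      ext l
      simp only [ι, Pi.basisFun_apply, Pi.smul_apply, Pi.add_apply, Finset.sum_apply, smul_eq_mul,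
        Pi.sub_apply, map_sub, map_mul, map_sum, sub_add_cancel]
      rw [Pi.single_apply, Pi.single_apply]
      split_ifs <;> simp
    rw [this]
    exact Submodule.add_mem_sup (Submodule.subset_span ⟨_, h i, rfl⟩) (Submodule.sum_mem _ fun j _ =>
      Submodule.smul_mem _ _ (Submodule.subset_span ⟨j, rfl⟩))
  have h1 := Submodule.finrank_add_le_finrank_add_finrank (residueSpan P U)
    (Submodule.span κ (Set.range fun j => ι (b j)))
  have h2 := finrank_range_le_card (R := κ) (fun j => ι (b j))
  rw [Fintype.card_fin] at h2
  rw [htop, finrank_top, Module.finrank_fin_fun] at h1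
  exact h1.trans (Nat.add_le_add_left h2 _)

theorem exists_smul_eq_of_mem_residueSpan {U : Submodule R (Fin d → R)}
    {w : Fin d → FractionRing (R ⧸ P)} (hw : w ∈ residueSpan P U) :
    ∃ s ∉ P, ∃ v ∈ U, ∀ i, algebraMap R (FractionRing (R ⧸ P)) (v i) =
      algebraMap R (FractionRing (R ⧸ P)) s * w i := by
  have hone : (1 : R) ∉ P := (Ideal.ne_top_iff_one P).1 (Ideal.IsPrime.ne_top ‹_›)
  refine Submodule.span_induction ?_ ?_ ?_ ?_ hw
  · rintro _ ⟨u, hu, rfl⟩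
    exact ⟨1, hone, u, hu, by simp⟩
  · exact ⟨1, hone, 0, U.zero_mem, by simp⟩
  · rintro a b - - ⟨s, hs, v, hv, h⟩ ⟨s', hs', v', hv', h'⟩
    refine ⟨s * s', fun hm => (Ideal.IsPrime.mem_or_mem ‹_› hm).elim hs hs',
      s' • v + s • v', U.add_mem (U.smul_mem _ hv) (U.smul_mem _ hv'), fun i => ?_⟩
    simp only [Pi.add_apply, Pi.smul_apply, smul_eq_mul, map_add, map_mul, h, h']
    ring
  · rintro c a - ⟨s, hs, v, hv, h⟩
    obtain ⟨s', hs', v', h'⟩ := Ideal.exists_smul_eq_algebraMap_fractionRing P (d := 1) fun _ => c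
    refine ⟨s' * s, fun hm => (Ideal.IsPrime.mem_or_mem ‹_› hm).elim hs' hs,
      v' 0 • v, U.smul_mem _ hv, fun i => ?_⟩
    simp only [Pi.smul_apply, smul_eq_mul, map_mul, h, h']
    ring

/-- Modulo `P`, the standard basis vectors are, up to scalars, combinations of `d - r` of them and
of vectors in `U`. -/
theorem exists_smul_single_sub_sum_mem (P : Ideal R) [P.IsPrime] (U : Submodule R (Fin d → R)) :
    ∃ (c : ℕ) (g : Fin c → Fin d),
      c = d - Module.finrank (FractionRing (R ⧸ P)) (residueSpan P (U : Set (Fin d → R))) ∧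
      ∀ i, ∃ s ∉ P, ∃ β : Fin c → R, ∃ v ∈ U,
        ∀ l, (s • (Pi.single i 1 : Fin d → R) -
          ∑ j, β j • (Pi.single (g j) 1 : Fin d → R) - v) l ∈ P := by
  obtain ⟨g, hg⟩ := (residueSpan P (U : Set (Fin d → R))).exists_sup_span_range_comp_eq_top
  refine ⟨_, g, rfl, fun i => ?_⟩
  have hmem : (Pi.single i 1 : Fin d → FractionRing (R ⧸ P)) ∈
      (⊤ : Submodule (FractionRing (R ⧸ P)) (Fin d → FractionRing (R ⧸ P))) := Submodule.mem_top
  rw [← hg] at hmem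
  obtain ⟨w, hw, z, hz, hwz⟩ := Submodule.mem_sup.1 hmem
  obtain ⟨γ, rfl⟩ := (Submodule.mem_span_range_iff_exists_fun _).1 hz
  obtain ⟨s, hs, v, hv, h⟩ := exists_smul_eq_of_mem_residueSpan hw
  obtain ⟨s', hs', β, hβ⟩ := Ideal.exists_smul_eq_algebraMap_fractionRing P γ
  refine ⟨s' * s, fun hm => (Ideal.IsPrime.mem_or_mem ‹_› hm).elim hs' hs, s • β, s' • v,
    U.smul_mem _ hv, fun l => ?_⟩
  rw [← Ideal.algebraMap_fractionRing_eq_zero_iff]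
  have hl := congrFun hwz l
  have hsing : ∀ j l : Fin d, algebraMap R (FractionRing (R ⧸ P)) ((Pi.single j 1 : Fin d → R) l) =
      (Pi.single j 1 : Fin d → FractionRing (R ⧸ P)) l := fun j l => by
    rw [Pi.single_apply, Pi.single_apply]; split_ifs <;> simp
  simp only [Pi.add_apply, Finset.sum_apply, Pi.smul_apply, smul_eq_mul, Pi.sub_apply, map_sub,
    map_mul, map_sum, h, hβ, hsing] at hl ⊢
  rw [← hl]
  simp only [mul_add, Finset.mul_sum, mul_assoc, mul_left_comm]
  ring

variable [IsNoetherianRing R]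

theorem height_add_finrank_le_height {U : Set (Fin d → R)} {Q : Ideal (MvPolynomial (Fin d) R)}
    [Q.IsPrime] (hQ : Q.comap C = P) (hU : ∀ u ∈ U, linForm u ∈ Q) :
    P.height + Module.finrank (FractionRing (R ⧸ P)) (residueSpan P U) ≤ Q.height :=
  (height_add_finrank_le_height_fiberIdeal _).trans (Ideal.height_mono (fiberIdeal_le hQ hU))

theorem height_fiberIdeal_residueSpan_le (U : Set (Fin d → R)) :
    (fiberIdeal P (residueSpan P U)).height ≤
      P.height + Module.finrank (FractionRing (R ⧸ P)) (residueSpan P U) := by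
  obtain ⟨w, hw, hspan, -⟩ := Submodule.exists_fun_fin_finrank_span_eq
    (FractionRing (R ⧸ P)) ((fun u i => algebraMap R (FractionRing (R ⧸ P)) (u i)) '' U)
  choose u hu huw using hw
  have h : residueSpan P (Set.range u) = residueSpan P U := by
    refine Eq.trans ?_ hspan
    rw [residueSpan, ← Set.range_comp]
    exact congrArg _ (congrArg _ (_root_.funext huw))
  have := height_fiberIdeal_le (P := P) u
  rwa [h] at this

end MvPolynomial

/-- A form of Nakayama's lemma at a prime ideal. -/
theorem Ideal.exists_mul_mem_of_forall_mem_sup_mul {R ι : Type*} [CommRing R] [Finite ι]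
    {P : Ideal R} [P.IsPrime] {N : Ideal R} (f : ι → R)
    (h : ∀ i, ∃ s ∉ P, s * f i ∈ N ⊔ P * Ideal.span (Set.range f)) {x : R}
    (hx : x ∈ Ideal.span (Set.range f)) : ∃ s ∉ P, s * x ∈ N := by
  have hfg : (Ideal.span (Set.range f)).FG := Submodule.fg_span (Set.finite_range f)
  have key : (Ideal.span (Set.range f)).map (algebraMap R (Localization.AtPrime P)) ≤
      N.map (algebraMap R (Localization.AtPrime P)) := by
    refine Submodule.le_of_le_smul_of_le_jacobson_bot
      (I := IsLocalRing.maximalIdeal (Localization.AtPrime P)) (hfg.map _)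
      (IsLocalRing.maximalIdeal_le_jacobson _)
      (Ideal.map_le_iff_le_comap.2 (Ideal.span_le.2 ?_))
    rintro _ ⟨i, rfl⟩
    obtain ⟨s, hs, hsx⟩ := h i
    rw [SetLike.mem_coe, Ideal.mem_comap, ← Localization.AtPrime.map_eq_maximalIdeal, smul_eq_mul,
      ← Ideal.map_mul, ← Ideal.map_sup,
      IsLocalization.algebraMap_mem_map_algebraMap_iff P.primeCompl]
    exact ⟨s, hs, hsx⟩
  exact (IsLocalization.algebraMap_mem_map_algebraMap_iff P.primeCompl _ _ _).1
    (key (Ideal.mem_map_of_mem _ hx))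

namespace Matrix

variable {R : Type*} [CommRing R] {m : ℕ}

/-- The signed maximal minors of an `(m + 1) × m` matrix. -/
def signedMinor (φ : Matrix (Fin (m + 1)) (Fin m) R) (i : Fin (m + 1)) : R :=
  (-1) ^ (i : ℕ) * (φ.submatrix i.succAbove id).det

theorem sum_mul_signedMinor (φ : Matrix (Fin (m + 1)) (Fin m) R) (y : Fin (m + 1) → R) :
    ∑ i, y i * signedMinor φ i =
      (Matrix.of fun i => Fin.cons (y i) (φ i) : Matrix (Fin (m + 1)) (Fin (m + 1)) R).det := by
  rw [det_succ_column_zero]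
  refine Finset.sum_congr rfl fun i _ => ?_
  rw [signedMinor, of_apply, Fin.cons_zero, mul_left_comm, mul_assoc]
  rfl

theorem sum_apply_mul_signedMinor (φ : Matrix (Fin (m + 1)) (Fin m) R) (j : Fin m) :
    ∑ i, φ i j * signedMinor φ i = 0 := by
  rw [sum_mul_signedMinor φ fun i => φ i j]
  exact det_zero_of_column_eq (Fin.succ_ne_zero j).symm fun i => by simp

/-- The Hilbert–Burch description of the syzygies of the maximal minors. -/
theorem exists_mulVec_eq_of_sum_mul_signedMinor_eq_zero [IsDomain R]
    [UniqueFactorizationMonoid R] (φ : Matrix (Fin (m + 1)) (Fin m) R)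
    (h0 : ∃ i, signedMinor φ i ≠ 0) (hφ : ∀ π, Prime π → ∃ i, ¬ π ∣ signedMinor φ i)
    {u : Fin (m + 1) → R} (hu : ∑ i, u i * signedMinor φ i = 0) : ∃ v, φ *ᵥ v = u := by
  rw [sum_mul_signedMinor, ← exists_mulVec_eq_zero_iff] at hu
  obtain ⟨w, hw0, hw⟩ := hu
  have hw' : ∀ i, u i * w 0 + (φ *ᵥ fun j => w j.succ) i = 0 := fun i => by
    have := congrFun hw i
    rw [mulVec, dotProduct, Fin.sum_univ_succ] at this
    simpa [mulVec, dotProduct] using this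
  have ha : w 0 ≠ 0 := by
    intro ha
    obtain ⟨i, hi⟩ := h0
    refine hi ?_
    rw [signedMinor, exists_mulVec_eq_zero_iff.1, mul_zero]
    refine ⟨fun j => w j.succ, fun h => hw0 ?_, ?_⟩
    · ext j
      exact Fin.cases ha (fun j => congrFun h j) j
    · ext l
      have := hw' (i.succAbove l)
      rwa [ha, mul_zero, zero_add] at this
  have hdvd : ∀ i j, w 0 ∣ signedMinor φ i * w (Fin.succ j) := by
    intro i j
    have h1 : (φ.submatrix i.succAbove id) *ᵥ (fun j => w j.succ) =
        -(w 0 • fun l => u (i.succAbove l)) := by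
      ext l
      have := hw' (i.succAbove l)
      simp only [Pi.neg_apply, Pi.smul_apply, smul_eq_mul]
      rw [← add_eq_zero_iff_eq_neg, add_comm, mul_comm (w 0)]
      exact this
    have h2 := congrArg (fun z => ((φ.submatrix i.succAbove id).adjugate *ᵥ z) j) h1
    simp only [mulVec_mulVec, adjugate_mul, smul_mulVec, one_mulVec, mulVec_neg, mulVec_smul,
      Pi.smul_apply, Pi.neg_apply, smul_eq_mul] at h2
    rw [signedMinor, mul_assoc, h2]
    exact Dvd.dvd.mul_left ((dvd_mul_right _ _).neg_right) _
  have hdvd' : ∀ j : Fin m, w 0 ∣ w j.succ := by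
    intro j
    obtain ⟨a', b', c', hrel, ha', hb'⟩ := UniqueFactorizationMonoid.exists_reduced_factors (w 0) ha
      (w j.succ)
    by_cases hunit : IsUnit a'
    · rw [← ha', ← hb']
      exact mul_dvd_mul_left _ hunit.dvd
    · exfalso
      have ha0 : a' ≠ 0 := by rintro rfl; exact ha (by rw [← ha', mul_zero])
      have hc0 : c' ≠ 0 := by rintro rfl; exact ha (by rw [← ha', zero_mul])
      obtain ⟨π, hπ, hπa⟩ := WfDvdMonoid.exists_irreducible_factor hunit ha0
      obtain ⟨i, hi⟩ := hφ π (UniqueFactorizationMonoid.irreducible_iff_prime.1 hπ)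
      refine hi (hπa.trans (hrel.dvd_of_dvd_mul_right ?_))
      have := hdvd i j
      rw [← ha', ← hb', mul_left_comm] at this
      exact (mul_dvd_mul_iff_left hc0).1 this
  choose v hv using hdvd'
  refine ⟨-v, ?_⟩
  ext i
  have h1 := hw' i
  have h2 : (fun j : Fin m => w j.succ) = w 0 • v := _root_.funext hv
  rw [h2, mulVec_smul, Pi.smul_apply, smul_eq_mul, mul_comm, ← mul_add] at h1
  rw [mulVec_neg, Pi.neg_apply]
  exact (eq_neg_of_add_eq_zero_left ((mul_eq_zero.1 h1).resolve_left ha)).symm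

end Matrix

theorem idealHeight_le_height {A : Type*} [CommRing A] {I P : Ideal A} [hP : P.IsPrime]
    (h : I ≤ P) : idealHeight I ≤ P.height := by
  have h1 := PrimeSpectrum.height_eq_orderHeight (⟨P, hP⟩ : PrimeSpectrum A)
  exact (iInf₂_le (⟨P, hP⟩ : PrimeSpectrum A) h).trans h1.ge

theorem idealHeight_eq_height {A : Type*} [CommRing A] (P : Ideal A) [hP : P.IsPrime] :
    idealHeight P = P.height := by
  refine le_antisymm (idealHeight_le_height le_rfl) (le_iInf₂ fun Q hQ => ?_)
  rw [← PrimeSpectrum.height_eq_orderHeight]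
  exact Ideal.height_mono hQ

section

variable {A : Type*} [CommRing A] {m : ℕ}

theorem minorsIdeal_eq_span_signedMinor (φ : Matrix (Fin (m + 1)) (Fin m) A) :
    minorsIdeal m φ = Ideal.span (Set.range (signedMinor φ)) := by
  have hunit : ∀ i : Fin (m + 1), (-1 : A) ^ (i : ℕ) * signedMinor φ i =
      (φ.submatrix i.succAbove id).det := fun i => by
    rw [signedMinor, ← mul_assoc, ← pow_add, Even.neg_one_pow ⟨_, rfl⟩, one_mul]
  refine le_antisymm (Ideal.span_le.2 ?_) (Ideal.span_le.2 ?_)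
  · rintro _ ⟨r, c, hr, hc, rfl⟩
    obtain ⟨i, hi⟩ : ∃ i, ∀ j, r j ≠ i := by
      by_contra! h
      have := Fintype.card_le_of_surjective r h
      simp at this
    choose ρ hρ using fun j => Fin.exists_succAbove_eq (hi j)
    have hρi : Function.Injective ρ := fun a b h => hr (by rw [← hρ, ← hρ, h])
    let σ := Equiv.ofBijective ρ (Finite.injective_iff_bijective.1 hρi)
    let τ := Equiv.ofBijective c (Finite.injective_iff_bijective.1 hc)
    have : φ.submatrix r c = (((φ.submatrix i.succAbove id).submatrix σ id)).submatrix id τ := by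
      ext a b
      simp [σ, τ, hρ]
    rw [this, det_permute', det_permute, ← hunit]
    exact Ideal.mul_mem_left _ _ (Ideal.mul_mem_left _ _ (Ideal.mul_mem_left _ _
      (Ideal.subset_span ⟨i, rfl⟩)))
  · rintro _ ⟨i, rfl⟩
    exact Ideal.mul_mem_left _ _ (Ideal.subset_span
      ⟨_, _, Fin.succAbove_right_injective, Function.injective_id, rfl⟩)

theorem exists_det_notMem_of_not_minorsIdeal_le {e : ℕ} {Ψ : Matrix (Fin e) (Fin m) A}
    {P : Ideal A} (h : ¬ minorsIdeal e Ψ ≤ P) :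
    ∃ c : Fin e → Fin m, (Ψ.submatrix id c).det ∉ P := by
  by_contra! hc
  refine h (Ideal.span_le.2 ?_)
  rintro _ ⟨r, c, hr, -, rfl⟩
  have : Ψ.submatrix r c = (Ψ.submatrix id c).submatrix
    (Equiv.ofBijective r (Finite.injective_iff_bijective.1 hr)) id := rfl
  rw [this, det_permute]
  exact Ideal.mul_mem_left _ _ (hc c)

/-- The Hilbert–Burch theorem for an ideal of maximal minors of height at least two. -/
theorem exists_mulVec_eq_of_two_le_height [IsDomain A] [IsNoetherianRing A]
    [UniqueFactorizationMonoid A] (φ : Matrix (Fin (m + 1)) (Fin m) A)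
    (hI : 2 ≤ idealHeight (minorsIdeal m φ)) {u : Fin (m + 1) → A}
    (hu : ∑ i, u i * signedMinor φ i = 0) : ∃ v, φ *ᵥ v = u := by
  rw [minorsIdeal_eq_span_signedMinor] at hI
  refine exists_mulVec_eq_of_sum_mul_signedMinor_eq_zero φ ?_ (fun π hπ => ?_) hu
  · by_contra! h
    have h1 : Ideal.span (Set.range (signedMinor φ)) ≤ ⊥ := by
      rw [Ideal.span_le]
      rintro _ ⟨i, rfl⟩
      exact h i
    have := hI.trans (idealHeight_le_height h1)
    rw [Ideal.height_bot] at this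
    exact absurd this (by norm_num)
  · by_contra! h
    have hp : (Ideal.span {π}).IsPrime := (Ideal.span_singleton_prime hπ.ne_zero).2 hπ
    have h1 : Ideal.span (Set.range (signedMinor φ)) ≤ Ideal.span {π} := by
      rw [Ideal.span_le]
      rintro _ ⟨i, rfl⟩
      exact Ideal.mem_span_singleton.2 (h i)
    have h2 := Ideal.height_le_one_of_isPrincipal_of_mem_minimalPrimes (Ideal.span {π})
      (Ideal.span {π}) (by rw [Ideal.minimalPrimes_eq_subsingleton_self]; rfl)
    have := (hI.trans (idealHeight_le_height h1)).trans h2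
    exact absurd this (by norm_num)

end

section

variable {R : Type*} [CommRing R] {d e m : ℕ}

/-- The syzygies of a tuple. -/
def syzygies (f : Fin d → R) : Submodule R (Fin d → R) :=
  LinearMap.ker (Fintype.linearCombination R f)

theorem mem_syzygies {f u : Fin d → R} : u ∈ syzygies f ↔ ∑ i, u i * f i = 0 := by
  simp [syzygies, Fintype.linearCombination_apply]

/-- The ideal of the symmetric algebra in the polynomial ring. -/
noncomputable def symIdeal (f : Fin d → R) : Ideal (MvPolynomial (Fin d) R) :=
  Ideal.span (linForm '' (syzygies f : Set (Fin d → R)))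

theorem reesPresentation_linForm (f u : Fin d → R) :
    reesPresentation f (linForm u) = Polynomial.C (∑ i, u i * f i) * Polynomial.X := by
  simp [reesPresentation, linForm_apply, Finset.sum_mul, mul_assoc, Polynomial.algebraMap_eq]

theorem linForm_mem_ker_reesPresentation {f u : Fin d → R} :
    linForm u ∈ RingHom.ker (reesPresentation f) ↔ u ∈ syzygies f := by
  rw [RingHom.mem_ker, reesPresentation_linForm, mem_syzygies]
  refine ⟨fun h => ?_, fun h => by rw [h]; simp⟩
  simpa using congrArg (fun p => Polynomial.coeff p 1) h

theorem symIdeal_le_ker (f : Fin d → R) : symIdeal f ≤ RingHom.ker (reesPresentation f) := by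
  rw [symIdeal, Ideal.span_le]
  rintro _ ⟨u, hu, rfl⟩
  exact linForm_mem_ker_reesPresentation.2 hu

theorem MvPolynomial.IsHomogeneous.exists_linForm_eq {p : MvPolynomial (Fin d) R}
    (hp : p.IsHomogeneous 1) : ∃ u, linForm u = p := by
  have h : p ∈ Submodule.span R (Set.range (X : Fin d → MvPolynomial (Fin d) R)) := by
    rw [← homogeneousSubmodule_one_eq_span_X]; exact hp
  obtain ⟨c, hc⟩ := (Submodule.mem_span_range_iff_exists_fun _).1 h
  exact ⟨c, by rw [← hc, linForm_apply]; simp [smul_eq_C_mul]⟩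

theorem linForm_isHomogeneous (u : Fin d → R) : (linForm u).IsHomogeneous 1 := by
  rw [linForm_apply]
  exact IsHomogeneous.sum _ _ _ fun i _ => isHomogeneous_C_mul_X _ _

theorem symIdeal_eq_span (f : Fin d → R) : symIdeal f =
    Ideal.span {p | p ∈ RingHom.ker (reesPresentation f) ∧ p.IsHomogeneous 1} := by
  rw [symIdeal]
  congr 1
  ext p
  constructor
  · rintro ⟨u, hu, rfl⟩
    exact ⟨linForm_mem_ker_reesPresentation.2 hu, linForm_isHomogeneous u⟩
  · rintro ⟨hp, h1⟩
    obtain ⟨u, rfl⟩ := h1.exists_linForm_eq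
    exact ⟨u, linForm_mem_ker_reesPresentation.1 hp, rfl⟩

variable (Φ₁ : Matrix (Fin d) (Fin m) R) (Φ₂ : Matrix (Fin e) (Fin m) R)

/-- The block matrix whose first row consists of the linear forms of the columns of `Φ₁`. -/
noncomputable def symRows : Fin (e + 1) → Fin m → MvPolynomial (Fin d) R :=
  Fin.cons (fun j => linForm fun i => Φ₁ i j) fun a j => C (Φ₂ a j)

variable {Φ₁ Φ₂}

theorem det_mul_mem_span {f₁ : Fin d → R} {f₂ : Fin e → R}
    (h : ∀ j, ∑ i, f₁ i * Φ₁ i j + ∑ l, f₂ l * Φ₂ l j = 0) (c : Fin e → Fin m) (l : Fin e) :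
    (Φ₂.submatrix id c).det * f₂ l ∈ Ideal.span (Set.range f₁) := by
  have h1 : f₂ ᵥ* (Φ₂.submatrix id c) = -fun a => ∑ i, f₁ i * Φ₁ i (c a) := by
    ext a
    exact eq_neg_of_add_eq_zero_right (h (c a))
  have h2 := congrFun (congrArg (fun z => z ᵥ* (Φ₂.submatrix id c).adjugate) h1) l
  rw [vecMul_vecMul, mul_adjugate] at h2
  simp only [vecMul_smul, vecMul_one, Pi.smul_apply, smul_eq_mul] at h2
  rw [h2, neg_vecMul, Pi.neg_apply, neg_mem_iff, vecMul, dotProduct]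
  refine Ideal.sum_mem _ fun a _ => Ideal.mul_mem_right _ _ (Ideal.sum_mem _ fun i _ => ?_)
  exact Ideal.mul_mem_right _ _ (Ideal.subset_span ⟨i, rfl⟩)

theorem det_mul_linForm_mem_valueIdeal {v : Fin m → R} (hv : Φ₂ *ᵥ v = 0) (c : Fin e → Fin m) :
    (C (Φ₂.submatrix id c).det * linForm (Φ₁ *ᵥ v) : MvPolynomial (Fin d) R) ∈
      EagonNorthcott.valueIdeal (symRows Φ₁ Φ₂) := by
  let g : (Fin m → MvPolynomial (Fin d) R) →ₗ[MvPolynomial (Fin d) R]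
      (Fin (e + 1) → MvPolynomial (Fin d) R) :=
    LinearMap.pi (Fin.cons (∑ j, (C (v j) : MvPolynomial (Fin d) R) • LinearMap.proj j)
      (fun l => LinearMap.proj (c l)) : Fin (e + 1) →
        (Fin m → MvPolynomial (Fin d) R) →ₗ[MvPolynomial (Fin d) R] MvPolynomial (Fin d) R)
  have hg0 : ∀ w, g w 0 = ∑ j, C (v j) * w j := fun w => by simp [g]
  have hgs : ∀ w (l : Fin e), g w l.succ = w (c l) := fun w l => by simp [g]
  rw [EagonNorthcott.mem_valueIdeal]
  refine ⟨(detRowAlternating (n := Fin (e + 1))).compLinearMap g, ?_⟩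
  change det (of fun a => g (symRows Φ₁ Φ₂ a)) = _
  rw [det_succ_column_zero, Finset.sum_eq_single 0]
  · have h1 : ((of fun a => g (symRows Φ₁ Φ₂ a)).submatrix (Fin.succAbove 0) Fin.succ) =
        (C : R →+* MvPolynomial (Fin d) R).mapMatrix (Φ₂.submatrix id c) := by
      ext1 a l
      simp [hgs, symRows]
    rw [h1, ← RingHom.map_det, of_apply, hg0]
    simp only [Fin.val_zero, pow_zero, one_mul, symRows, Fin.cons_zero]
    rw [mul_comm]
    congr 1
    simp only [← smul_eq_C_mul, ← map_smul, ← map_sum]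
    congr 1
    ext i
    simp [mulVec, dotProduct, mul_comm]
  · intro a _ ha
    obtain ⟨a, rfl⟩ := Fin.exists_succ_eq.2 ha
    rw [of_apply, hg0]
    have : ∑ j, C (v j) * symRows Φ₁ Φ₂ a.succ j = 0 := by
      have := congrArg (C : R → MvPolynomial (Fin d) R) (congrFun hv a)
      simpa [symRows, mulVec, dotProduct, mul_comm] using this
    rw [this, mul_zero, zero_mul]
  · simp

theorem valueIdeal_le_symIdeal {f : Fin d → R}
    (h : ∀ v, Φ₂ *ᵥ v = 0 → Φ₁ *ᵥ v ∈ syzygies f) :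
    EagonNorthcott.valueIdeal (symRows Φ₁ Φ₂) ≤ symIdeal f := by
  intro x hx
  obtain ⟨lam, rfl⟩ := EagonNorthcott.mem_valueIdeal.1 hx
  let Ψ₂ : Fin e → Fin m → MvPolynomial (Fin d) R := fun a j => C (Φ₂ a j)
  have hlin : ∀ w : Fin m → MvPolynomial (Fin d) R, lam (Fin.cons w Ψ₂) =
      ∑ j, w j * lam (Fin.cons (Pi.single j 1) Ψ₂) := by
    intro w
    have h1 : ∀ w, lam (Fin.cons w Ψ₂) = lam.toMultilinearMap.toLinearMap (Fin.cons 0 Ψ₂) 0 w :=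
      fun w => by simp
    conv_lhs => rw [h1, pi_eq_sum_univ' w, map_sum]
    refine Finset.sum_congr rfl fun j _ => ?_
    rw [map_smul, smul_eq_mul, h1]
  set y : Fin m → MvPolynomial (Fin d) R := fun j => lam (Fin.cons (Pi.single j 1) Ψ₂) with hy
  have hker : ∀ a, ∑ j, C (Φ₂ a j) * y j = 0 := by
    intro a
    rw [← hlin (Ψ₂ a)]
    exact lam.map_eq_zero_of_eq _ (i := 0) (j := a.succ) (by simp) (Fin.succ_ne_zero a).symm
  have hsyz : ∀ t, (Φ₁ *ᵥ fun j => coeff t (y j)) ∈ syzygies f := fun t => h _ (by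
    ext a
    simpa [coeff_sum, coeff_C_mul, mulVec, dotProduct] using congrArg (coeff t) (hker a))
  change lam (Fin.cons (fun j => linForm fun i => Φ₁ i j) Ψ₂) ∈ _
  rw [hlin]
  classical
  let T := Finset.univ.biUnion fun j => (y j).support
  have hT : ∀ j, y j = ∑ t ∈ T, monomial t (coeff t (y j)) := fun j => by
    conv_lhs => rw [(y j).as_sum]
    exact Finset.sum_subset (fun t ht => Finset.mem_biUnion.2 ⟨j, Finset.mem_univ _, ht⟩)
      fun t _ ht => by rw [notMem_support_iff.1 ht, monomial_zero]
  have : ∑ j, (linForm fun i => Φ₁ i j) * y j =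
      ∑ t ∈ T, monomial t 1 * linForm (Φ₁ *ᵥ fun j => coeff t (y j)) := by
    rw [Finset.sum_congr rfl fun j _ => by rw [hT j, Finset.mul_sum], Finset.sum_comm]
    refine Finset.sum_congr rfl fun t _ => ?_
    have : (Φ₁ *ᵥ fun j => coeff t (y j)) = ∑ j, coeff t (y j) • fun i => Φ₁ i j := by
      ext i
      simp [mulVec, dotProduct, mul_comm]
    rw [this, map_sum, Finset.mul_sum]
    refine Finset.sum_congr rfl fun j _ => ?_
    rw [map_smul, smul_eq_C_mul, mul_comm, ← mul_assoc, mul_comm (monomial t 1), C_mul_monomial,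
      mul_one]
  exact this ▸ Ideal.sum_mem _ fun t _ =>
    Ideal.mul_mem_left _ _ (Ideal.subset_span ⟨_, hsyz t, rfl⟩)

end

section

variable {R : Type*} [CommRing R] {d n : ℕ}

theorem smul_single_sub_smul_single_mem_syzygies (f : Fin d → R) (i j : Fin d) :
    f j • (Pi.single i 1 : Fin d → R) - f i • (Pi.single j 1 : Fin d → R) ∈ syzygies f := by
  rw [mem_syzygies]
  simp [mul_sub, Finset.sum_sub_distrib, Pi.single_apply, mul_comm]

theorem exists_pow_mul_sub_aeval_mem_symIdeal (f : Fin d → R) (j : Fin d)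
    (p : MvPolynomial (Fin d) R) : ∃ (N : ℕ) (g : Polynomial R),
      C (f j ^ N) * p - Polynomial.aeval (X j) g ∈ symIdeal f := by
  induction p using MvPolynomial.induction_on with
  | C a => exact ⟨0, Polynomial.C a, by simp [MvPolynomial.algebraMap_eq]⟩
  | add p q hp hq =>
    obtain ⟨N, g, h⟩ := hp
    obtain ⟨N', g', h'⟩ := hq
    refine ⟨N + N', Polynomial.C (f j ^ N') * g + Polynomial.C (f j ^ N) * g', ?_⟩
    convert add_mem (Ideal.mul_mem_left _ (C (f j ^ N')) h) (Ideal.mul_mem_left _ (C (f j ^ N)) h')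
      using 1
    simp only [map_add, map_mul, Polynomial.aeval_C, MvPolynomial.algebraMap_eq, pow_add]
    ring
  | mul_X p i hp =>
    obtain ⟨N, g, h⟩ := hp
    refine ⟨N + 1, Polynomial.C (f i) * g * Polynomial.X, ?_⟩
    have h2 : linForm _ ∈ symIdeal f :=
      Ideal.subset_span ⟨_, smul_single_sub_smul_single_mem_syzygies f i j, rfl⟩
    rw [map_sub, map_smul, map_smul, linForm_single, linForm_single, smul_eq_C_mul,
      smul_eq_C_mul] at h2
    convert add_mem (Ideal.mul_mem_left _ (C (f i) * X j) h)
      (Ideal.mul_mem_left _ (C (f j ^ N) * p) h2) using 1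
    simp only [map_mul, Polynomial.aeval_C, Polynomial.aeval_X, MvPolynomial.algebraMap_eq,
      pow_succ]
    ring

theorem exists_C_mul_mem_symIdeal [IsDomain R] {f : Fin d → R} {j : Fin d} (hj : f j ≠ 0)
    {p : MvPolynomial (Fin d) R} (hp : p ∈ RingHom.ker (reesPresentation f)) :
    ∃ r ≠ 0, C r * p ∈ symIdeal f := by
  obtain ⟨N, g, h⟩ := exists_pow_mul_sub_aeval_mem_symIdeal f j p
  refine ⟨f j ^ N, pow_ne_zero _ hj, ?_⟩
  have h1 := symIdeal_le_ker f h
  rw [RingHom.mem_ker, map_sub, map_mul, RingHom.mem_ker.1 hp, mul_zero, zero_sub, neg_eq_zero,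
    ← Polynomial.aeval_algHom_apply] at h1
  have hg : g = 0 := by
    ext l
    have := congrArg (fun q => Polynomial.coeff q l) h1
    simp only [reesPresentation, aeval_X, ← Polynomial.comp_eq_aeval,
      Polynomial.comp_C_mul_X_coeff, Polynomial.coeff_zero] at this
    simpa [hj] using this
  rwa [hg, map_zero, sub_zero] at h

/-- Being of linear type does not depend on the chosen generators. -/
theorem ker_reesPresentation_eq_of_span_eq {f : Fin d → R} {g : Fin n → R}
    (hfg : Ideal.span (Set.range f) = Ideal.span (Set.range g))
    (h : RingHom.ker (reesPresentation f) = symIdeal f) :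
    RingHom.ker (reesPresentation g) = symIdeal g := by
  have hA : ∀ i, ∃ a : Fin n → R, ∑ j, a j * g j = f i := fun i =>
    (Ideal.mem_span_range_iff_exists_fun).1 (hfg ▸ Ideal.subset_span ⟨i, rfl⟩)
  have hB : ∀ j, ∃ b : Fin d → R, ∑ i, b i * f i = g j := fun j =>
    (Ideal.mem_span_range_iff_exists_fun).1 (hfg ▸ Ideal.subset_span ⟨j, rfl⟩)
  choose A hA using hA
  choose B hB using hB
  let σ : MvPolynomial (Fin n) R →ₐ[R] MvPolynomial (Fin d) R := aeval fun j => linForm (B j)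
  let τ : MvPolynomial (Fin d) R →ₐ[R] MvPolynomial (Fin n) R := aeval fun i => linForm (A i)
  have hσ : (reesPresentation f).comp σ = reesPresentation g := by
    ext1 j
    rw [AlgHom.comp_apply, aeval_X, reesPresentation_linForm, hB, reesPresentation, aeval_X]
  have hτ : (reesPresentation g).comp τ = reesPresentation f := by
    ext1 i
    rw [AlgHom.comp_apply, aeval_X, reesPresentation_linForm, hA, reesPresentation, aeval_X]
  have hτl : ∀ u, τ (linForm u) = linForm (∑ i, u i • A i) := fun u => by
    rw [linForm_apply, map_sum, map_sum]
    refine Finset.sum_congr rfl fun i _ => ?_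
    rw [map_mul, aeval_X, map_smul, smul_eq_C_mul, ← MvPolynomial.algebraMap_eq, AlgHom.commutes,
      MvPolynomial.algebraMap_eq]
  have hquot : (Ideal.Quotient.mkₐ R (symIdeal g)).comp (τ.comp σ) =
      Ideal.Quotient.mkₐ R (symIdeal g) := by
    ext1 j
    simp only [AlgHom.comp_apply, σ, aeval_X, hτl, Ideal.Quotient.mkₐ_eq_mk]
    rw [Ideal.Quotient.mk_eq_mk_iff_sub_mem, ← linForm_single, ← map_sub]
    refine Ideal.subset_span ⟨_, linForm_mem_ker_reesPresentation.1 ?_, rfl⟩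
    rw [RingHom.mem_ker, map_sub, ← hτl, linForm_single, map_sub, ← AlgHom.comp_apply, hτ,
      reesPresentation_linForm, hB]
    simp [reesPresentation]
  refine le_antisymm (fun p hp => ?_) (symIdeal_le_ker g)
  have h1 : σ p ∈ symIdeal f := by
    rw [← h, RingHom.mem_ker, ← AlgHom.comp_apply, hσ]
    exact hp
  have h2 : symIdeal f ≤ (symIdeal g).comap τ := by
    rw [symIdeal, Ideal.span_le]
    rintro _ ⟨u, hu, rfl⟩
    rw [SetLike.mem_coe, Ideal.mem_comap, hτl]
    refine Ideal.subset_span ⟨_, linForm_mem_ker_reesPresentation.1 ?_, rfl⟩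
    rw [RingHom.mem_ker, ← hτl, ← AlgHom.comp_apply, hτ]
    exact linForm_mem_ker_reesPresentation.2 hu
  have h3 := AlgHom.congr_fun hquot p
  rw [AlgHom.comp_apply, Ideal.Quotient.mkₐ_eq_mk, AlgHom.comp_apply,
    Ideal.Quotient.eq_zero_iff_mem.2 (Ideal.mem_comap.1 (h2 h1))] at h3
  exact Ideal.Quotient.eq_zero_iff_mem.1 h3.symm

theorem Ideal.isLinearType_span_range_iff (f : Fin d → R) :
    (Ideal.span (Set.range f)).IsLinearType ↔
      RingHom.ker (reesPresentation f) = symIdeal f := by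
  refine ⟨fun h => (h d f rfl).trans (symIdeal_eq_span f).symm, fun h n g hg => ?_⟩
  exact (ker_reesPresentation_eq_of_span_eq hg.symm h).trans (symIdeal_eq_span g)

end

section

variable {R : Type u} [CommRing R] {d e m : ℕ}

theorem le_finrank_residueSpan_syzygies_add {P : Ideal R} [P.IsPrime] {f : Fin d → R} {c : ℕ}
    {g : Fin c → R} {δ : R} (hδ : δ ∉ P) (hg : ∀ j, δ * g j ∈ Ideal.span (Set.range f))
    (hf : ∀ i, ∃ s ∉ P, s * f i ∈ Ideal.span (Set.range g)) :
    d ≤ Module.finrank (FractionRing (R ⧸ P)) (residueSpan P (syzygies f : Set (Fin d → R))) + c := by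
  choose s hs hsf using hf
  choose a ha using fun i => Ideal.mem_span_range_iff_exists_fun.1 (hsf i)
  choose b hb using fun j => Ideal.mem_span_range_iff_exists_fun.1 (hg j)
  refine le_finrank_residueSpan_add (s := fun i => δ * s i)
    (fun i hm => (Ideal.IsPrime.mem_or_mem ‹_› hm).elim hδ (hs i)) a b fun i => ?_
  rw [SetLike.mem_coe, mem_syzygies]
  simp only [Pi.sub_apply, Pi.smul_apply, Finset.sum_apply, smul_eq_mul, sub_mul,
    Finset.sum_sub_distrib, Finset.sum_mul]
  rw [Finset.sum_comm (s := Finset.univ) (t := Finset.univ)]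
  simp only [mul_assoc, ← Finset.mul_sum, hb]
  rw [sub_eq_zero, Finset.sum_eq_single i (fun j _ hj => by simp [hj]) (by simp)]
  simp only [Pi.single_eq_same, one_mul, ← ha, Finset.mul_sum]
  exact Finset.sum_congr rfl fun j _ => by ring

theorem le_finrank_residueSpan_syzygies_add_one {P : Ideal R} [P.IsPrime] {f : Fin d → R}
    {i : Fin d} (hi : f i ∉ P) :
    d ≤ Module.finrank (FractionRing (R ⧸ P)) (residueSpan P (syzygies f : Set (Fin d → R))) + 1 :=
  le_finrank_residueSpan_syzygies_add (g := fun _ => f i) (δ := 1)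
    ((Ideal.ne_top_iff_one P).1 (Ideal.IsPrime.ne_top ‹_›))
    (fun _ => Ideal.mul_mem_left _ _ (Ideal.subset_span ⟨i, rfl⟩))
    fun l => ⟨f i, hi, mul_comm (f l) (f i) ▸ Ideal.mul_mem_left _ _ (Ideal.subset_span ⟨0, rfl⟩)⟩

variable {f₁ : Fin d → R} {f₂ : Fin e → R}
  {Φ₁ : Matrix (Fin d) (Fin m) R} {Φ₂ : Matrix (Fin e) (Fin m) R}

theorem linForm_mem_of_valueIdeal_le {Q : Ideal (MvPolynomial (Fin d) R)} [Q.IsPrime]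
    (hsyz : ∀ u ∈ syzygies f₁, ∃ v, Φ₂ *ᵥ v = 0 ∧ Φ₁ *ᵥ v = u)
    (hQ : EagonNorthcott.valueIdeal (symRows Φ₁ Φ₂) ≤ Q) {c : Fin e → Fin m}
    (hc : (Φ₂.submatrix id c).det ∉ Q.comap C) : ∀ u ∈ syzygies f₁, linForm u ∈ Q := by
  intro u hu
  obtain ⟨v, hv, rfl⟩ := hsyz u hu
  exact (Ideal.IsPrime.mem_or_mem ‹_› (hQ (det_mul_linForm_mem_valueIdeal hv c))).resolve_left hc

theorem det_mul_mem_of_mem_sup (hrel : ∀ j, ∑ i, f₁ i * Φ₁ i j + ∑ l, f₂ l * Φ₂ l j = 0)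
    (c : Fin e → Fin m) {x : R} (hx : x ∈ Ideal.span (Set.range f₁) ⊔ Ideal.span (Set.range f₂)) :
    (Φ₂.submatrix id c).det * x ∈ Ideal.span (Set.range f₁) := by
  obtain ⟨y, hy, z, hz, rfl⟩ := Submodule.mem_sup.1 hx
  rw [mul_add]
  refine add_mem (Ideal.mul_mem_left _ _ hy) ?_
  obtain ⟨b, rfl⟩ := Ideal.mem_span_range_iff_exists_fun.1 hz
  rw [Finset.mul_sum]
  refine Ideal.sum_mem _ fun l _ => ?_
  rw [mul_left_comm]
  exact Ideal.mul_mem_left _ _ (det_mul_mem_span hrel c l)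

theorem le_height_of_valueIdeal_le [IsNoetherianRing R] [IsDomain R]
    (hrel : ∀ j, ∑ i, f₁ i * Φ₁ i j + ∑ l, f₂ l * Φ₂ l j = 0)
    (hsyz : ∀ u ∈ syzygies f₁, ∃ v, Φ₂ *ᵥ v = 0 ∧ Φ₁ *ᵥ v = u)
    (hht : ∀ P : Ideal R, P.IsPrime → minorsIdeal e Φ₂ ≤ P → (d : ℕ∞) ≤ P.height)
    {i₀ : Fin d} (hi₀ : f₁ i₀ ≠ 0)
    (hG : CondG (Ideal.span (Set.range f₁) ⊔ Ideal.span (Set.range f₂)) d)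
    {Q : Ideal (MvPolynomial (Fin d) R)} [Q.IsPrime]
    (hQ : EagonNorthcott.valueIdeal (symRows Φ₁ Φ₂) ≤ Q) :
    ((d - 1 : ℕ) : ℕ∞) ≤ Q.height ∧ (Q.comap C ≠ ⊥ → (d : ℕ∞) ≤ Q.height) := by
  have hle : (Q.comap C).height ≤ Q.height :=
    le_self_add.trans (height_add_finrank_le_height (P := Q.comap C) (U := ∅) rfl (by simp))
  have hd1 : ((d - 1 : ℕ) : ℕ∞) ≤ d := by exact_mod_cast Nat.sub_le d 1
  by_cases hbig : (d : ℕ∞) ≤ (Q.comap C).height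
  · exact ⟨hd1.trans (hbig.trans hle), fun _ => hbig.trans hle⟩
  obtain ⟨c, hc⟩ := exists_det_notMem_of_not_minorsIdeal_le
    fun h => hbig (hht (Q.comap C) (Ideal.comap_isPrime _ _) h)
  have hlin := height_add_finrank_le_height (P := Q.comap C) rfl
    (linForm_mem_of_valueIdeal_le hsyz hQ hc)
  set P := Q.comap C with hP
  set r := Module.finrank (FractionRing (R ⧸ P)) (residueSpan P (syzygies f₁ : Set (Fin d → R)))
  have hPtop : P.height ≠ ⊤ := fun h => hbig (h ▸ le_top)
  by_cases hbot : P = ⊥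
  · refine ⟨?_, fun h => absurd hbot h⟩
    have h1 : d ≤ r + 1 := le_finrank_residueSpan_syzygies_add_one (i := i₀) (by rwa [hbot])
    have h2 : ((d - 1 : ℕ) : ℕ∞) ≤ r := by exact_mod_cast Nat.sub_le_of_le_add h1
    exact h2.trans (le_add_self.trans hlin)
  suffices h : (d : ℕ∞) ≤ Q.height from ⟨hd1.trans h, fun _ => h⟩
  refine le_trans ?_ hlin
  by_cases hI : Ideal.span (Set.range f₁) ⊔ Ideal.span (Set.range f₂) ≤ P
  · rw [not_le, ← ENat.add_one_le_iff hPtop, ← idealHeight_eq_height] at hbig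
    obtain ⟨c', hc', g, hg, hgen⟩ := hG P inferInstance hI hbig
    have h1 : d ≤ r + c' := le_finrank_residueSpan_syzygies_add hc
      (fun j => det_mul_mem_of_mem_sup hrel c (hg j))
      fun i => hgen _ (Ideal.mem_sup_left (Ideal.subset_span ⟨i, rfl⟩))
    rw [idealHeight_eq_height] at hc'
    calc (d : ℕ∞) ≤ ((r + c' : ℕ) : ℕ∞) := by exact_mod_cast h1
      _ = c' + r := by push_cast; rw [add_comm]
      _ ≤ _ := by gcongr
  · have hex : ∃ i, f₁ i ∉ P := by
      by_contra! hall
      have hJ : Ideal.span (Set.range f₁) ≤ P := Ideal.span_le.2 (by rintro _ ⟨i, rfl⟩; exact hall i)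
      refine hI (sup_le hJ (Ideal.span_le.2 ?_))
      rintro _ ⟨l, rfl⟩
      exact (Ideal.IsPrime.mem_or_mem inferInstance (hJ (det_mul_mem_span hrel c l))).resolve_left hc
    obtain ⟨i, hi⟩ := hex
    have h1 : d ≤ r + 1 := le_finrank_residueSpan_syzygies_add_one hi
    have h0 : 1 ≤ P.height := by
      rw [Order.one_le_iff_ne_zero]
      exact fun h0 => hbot (Ideal.height_eq_zero_iff_eq_bot.1 h0)
    calc (d : ℕ∞) ≤ ((r + 1 : ℕ) : ℕ∞) := by exact_mod_cast h1
      _ = 1 + r := by push_cast; rw [add_comm]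
      _ ≤ _ := by gcongr

end

section

variable {R : Type u} [CommRing R] [IsDomain R] {d e m : ℕ} {f₁ : Fin d → R} {f₂ : Fin e → R}
  {Φ₁ : Matrix (Fin d) (Fin m) R} {Φ₂ : Matrix (Fin e) (Fin m) R}

theorem ker_reesPresentation_eq_symIdeal [IsRegularRing R] (hde : d + e = m + 1) (hd : 1 ≤ d)
    (hrel : ∀ j, ∑ i, f₁ i * Φ₁ i j + ∑ l, f₂ l * Φ₂ l j = 0)
    (hsyz : ∀ u ∈ syzygies f₁, ∃ v, Φ₂ *ᵥ v = 0 ∧ Φ₁ *ᵥ v = u)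
    (hsyz' : ∀ v, Φ₂ *ᵥ v = 0 → Φ₁ *ᵥ v ∈ syzygies f₁)
    (hht : ∀ P : Ideal R, P.IsPrime → minorsIdeal e Φ₂ ≤ P → (d : ℕ∞) ≤ P.height)
    {i₀ : Fin d} (hi₀ : f₁ i₀ ≠ 0)
    (hG : CondG (Ideal.span (Set.range f₁) ⊔ Ideal.span (Set.range f₂)) d) :
    RingHom.ker (reesPresentation f₁) = symIdeal f₁ := by
  refine le_antisymm (le_trans ?_ (valueIdeal_le_symIdeal hsyz')) (symIdeal_le_ker f₁)
  set L := EagonNorthcott.valueIdeal (symRows Φ₁ Φ₂) with hL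
  have hq : m - e = d - 1 := by omega
  have hheight := fun (Q : Ideal (MvPolynomial (Fin d) R)) (hQ : Q.IsPrime) (hle : L ≤ Q) =>
    le_height_of_valueIdeal_le hrel hsyz hht hi₀ hG hle
  obtain ⟨c, hc⟩ := exists_det_notMem_of_not_minorsIdeal_le (P := (⊥ : Ideal R)) (Ψ := Φ₂)
    fun h => by
      have := hht ⊥ Ideal.isPrime_bot h
      rw [Ideal.height_bot] at this
      have : d ≤ 0 := by exact_mod_cast this
      omega
  rw [Ideal.mem_bot] at hc
  by_contra hker
  have : Nontrivial (Submodule.map L.mkQ (RingHom.ker (reesPresentation f₁))) := by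
    rw [Submodule.nontrivial_iff_ne_bot, Ne, ← le_bot_iff, Submodule.map_le_iff_le_comap,
      Submodule.comap_bot, Submodule.ker_mkQ]
    exact hker
  obtain ⟨Q, hQ⟩ := associatedPrimes.nonempty (MvPolynomial (Fin d) R)
    (Submodule.map L.mkQ (RingHom.ker (reesPresentation f₁)))
  obtain ⟨hQp, ⟨_, p, hp, rfl⟩, hQe⟩ := isAssociatedPrime_iff.1 hQ
  have hmem : ∀ z, z ∈ Q ↔ z * p ∈ L := fun z => by
    rw [hQe, Submodule.mem_colon_singleton, Submodule.mem_bot, ← Subtype.coe_inj]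
    change z • L.mkQ p = 0 ↔ _
    rw [← map_smul, smul_eq_mul, Submodule.mkQ_apply, Submodule.Quotient.mk_eq_zero]
  have hLQ : L ≤ Q := fun z hz => (hmem z).2 (L.mul_mem_right _ hz)
  obtain ⟨r, hr, hrp⟩ := exists_C_mul_mem_symIdeal hi₀ hp
  have hδ : ∀ x ∈ symIdeal f₁, C (Φ₂.submatrix id c).det * x ∈ L := by
    refine fun x hx => (Submodule.span_le (p := Submodule.comap (LinearMap.mulLeft
      (MvPolynomial (Fin d) R) (C (Φ₂.submatrix id c).det)) L)).2 ?_ hx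
    rintro _ ⟨u, hu, rfl⟩
    obtain ⟨v, hv, rfl⟩ := hsyz u hu
    exact det_mul_linForm_mem_valueIdeal hv c
  have hQd := (hheight Q hQp hLQ).2 <| by
    refine (Submodule.ne_bot_iff _).2 ⟨(Φ₂.submatrix id c).det * r, ?_, mul_ne_zero hc hr⟩
    rw [Ideal.mem_comap, hmem, map_mul, mul_assoc]
    exact hδ _ hrp
  refine hQp.ne_top ((Ideal.eq_top_iff_one _).2 ((hmem 1).2 ?_))
  rw [one_mul]
  refine EagonNorthcott.mem_valueIdeal_of_height _ (fun P hP hle => hq ▸ (hheight P hP hle).1) Q ?_ p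
    fun x hx => (hmem x).1 hx
  rwa [hq, Nat.sub_add_cancel hd]

theorem condG_of_ker_reesPresentation_eq_symIdeal [IsNoetherianRing R]
    (hrel : ∀ j, ∑ i, f₁ i * Φ₁ i j + ∑ l, f₂ l * Φ₂ l j = 0)
    (hht : ∀ P : Ideal R, P.IsPrime → minorsIdeal e Φ₂ ≤ P → (d : ℕ∞) ≤ P.height)
    {i₀ : Fin d} (hi₀ : f₁ i₀ ≠ 0) (hker : RingHom.ker (reesPresentation f₁) = symIdeal f₁) :
    CondG (Ideal.span (Set.range f₁) ⊔ Ideal.span (Set.range f₂)) d := by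
  intro P hP hIP hPd
  rw [idealHeight_eq_height] at hPd ⊢
  have hPtop : P.height ≠ ⊤ := fun h => by simp [h] at hPd
  obtain ⟨c, hc⟩ := exists_det_notMem_of_not_minorsIdeal_le (P := P) (Ψ := Φ₂)
    fun h => (not_le.2 ((ENat.add_one_le_iff hPtop).1 hPd)) (hht P hP h)
  have hJ : ∀ i, f₁ i ∈ Ideal.span (Set.range f₁) := fun i => Ideal.subset_span ⟨i, rfl⟩
  have hKp : (RingHom.ker (reesPresentation f₁)).IsPrime := RingHom.ker_isPrime _
  have hK0 : (RingHom.ker (reesPresentation f₁)).comap C = ⊥ := by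
    rw [eq_bot_iff]
    intro r hr
    simpa [RingHom.mem_ker, reesPresentation, Polynomial.algebraMap_eq] using hr
  obtain ⟨n, g, hn, hg⟩ := exists_smul_single_sub_sum_mem P (syzygies f₁)
  set r := Module.finrank (FractionRing (R ⧸ P)) (residueSpan P (syzygies f₁ : Set (Fin d → R)))
  have hdr : (d : ℕ∞) ≤ P.height + r := by
    have h1 := height_add_finrank_le_height (P := ⊥) hK0
      (U := (syzygies f₁ : Set (Fin d → R))) fun u hu => linForm_mem_ker_reesPresentation.2 hu
    have h2 : d ≤ Module.finrank (FractionRing (R ⧸ (⊥ : Ideal R)))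
        (residueSpan ⊥ (syzygies f₁ : Set (Fin d → R))) + 1 :=
      le_finrank_residueSpan_syzygies_add_one (i := i₀) (by simpa using hi₀)
    have h3 : RingHom.ker (reesPresentation f₁) <
        fiberIdeal P (residueSpan P (syzygies f₁ : Set (Fin d → R))) := by
      refine lt_of_le_of_ne ?_ fun h => ?_
      · rw [hker, symIdeal, Ideal.span_le]
        rintro _ ⟨u, hu, rfl⟩
        exact linForm_mem_fiberIdeal.2 (Submodule.subset_span ⟨u, hu, rfl⟩)
      · have h4 : C (f₁ i₀) ∈ fiberIdeal P (residueSpan P (syzygies f₁ : Set (Fin d → R))) :=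
          C_mem_fiberIdeal.2 (hIP (Ideal.mem_sup_left (hJ i₀)))
        rw [← h, ← Ideal.mem_comap, hK0] at h4
        exact hi₀ h4
    calc (d : ℕ∞) ≤ (Module.finrank (FractionRing (R ⧸ (⊥ : Ideal R)))
          (residueSpan ⊥ (syzygies f₁ : Set (Fin d → R))) : ℕ∞) + 1 := by exact_mod_cast h2
      _ ≤ (RingHom.ker (reesPresentation f₁)).height + 1 := by
        gcongr; exact le_add_self.trans h1
      _ ≤ _ := Ideal.height_add_one_le_of_lt_of_isPrime h3
      _ ≤ _ := height_fiberIdeal_residueSpan_le _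
  refine ⟨n, ?_, f₁ ∘ g, fun i => Ideal.mem_sup_left (hJ _), fun x hx => ?_⟩
  · lift P.height to ℕ using hPtop with p
    rw [hn]
    have : d ≤ p + r := by exact_mod_cast hdr
    exact_mod_cast Nat.sub_le_of_le_add this
  · have hgen : ∀ i, ∃ s ∉ P, s * f₁ i ∈
        Ideal.span (Set.range (f₁ ∘ g)) ⊔ P * Ideal.span (Set.range f₁) := by
      intro i
      obtain ⟨s, hs, β, v, hv, hl⟩ := hg i
      refine ⟨s, hs, ?_⟩
      have h1 : s * f₁ i = ∑ j, β j * f₁ (g j) + ∑ l, (s • (Pi.single i 1 : Fin d → R) -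
          ∑ j, β j • (Pi.single (g j) 1 : Fin d → R) - v) l * f₁ l := by
        simp only [Pi.sub_apply, sub_mul, Finset.sum_sub_distrib, mem_syzygies.1 hv, sub_zero,
          Pi.smul_apply, Finset.sum_apply, smul_eq_mul, Finset.sum_mul]
        rw [Finset.sum_comm (s := Finset.univ (α := Fin d))]
        simp [Pi.single_apply]
      rw [h1]
      exact Submodule.add_mem_sup
        (Ideal.sum_mem _ fun j _ => Ideal.mul_mem_left _ _ (Ideal.subset_span ⟨j, rfl⟩))
        (Ideal.sum_mem _ fun l _ => Ideal.mul_mem_mul (hl l) (hJ l))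
    obtain ⟨s, hs, hsx⟩ := Ideal.exists_mul_mem_of_forall_mem_sup_mul f₁ hgen
      (det_mul_mem_of_mem_sup hrel c hx)
    exact ⟨s * (Φ₂.submatrix id c).det, fun h => (hP.mem_or_mem h).elim hs hc, by rwa [mul_assoc]⟩

end

theorem isLinearType_span_signedMinor_iff {R : Type u} [CommRing R] [IsDomain R] [IsRegularRing R]
    [UniqueFactorizationMonoid R] {d e m : ℕ} (hd : 1 ≤ d) (σ : Fin d ⊕ Fin e ≃ Fin (m + 1))
    (φ : Matrix (Fin (m + 1)) (Fin m) R) (hI : idealHeight (minorsIdeal m φ) = 2)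
    (hht : (d : ℕ∞) ≤ idealHeight (minorsIdeal e (φ.submatrix (σ ∘ Sum.inr) id))) :
    (Ideal.span (Set.range fun i => signedMinor φ (σ (Sum.inl i)))).IsLinearType ↔
      CondG (minorsIdeal m φ) d := by
  have hde : d + e = m + 1 := by simpa using Fintype.card_congr σ
  have hsum : ∀ w : Fin (m + 1) → R,
      ∑ i, w i = ∑ i, w (σ (Sum.inl i)) + ∑ l, w (σ (Sum.inr l)) := fun w => by
    rw [← σ.sum_comp, Fintype.sum_sum_type]
  set Φ₁ := φ.submatrix (σ ∘ Sum.inl) id with hΦ₁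
  set Φ₂ := φ.submatrix (σ ∘ Sum.inr) id with hΦ₂
  set f₁ : Fin d → R := fun i => signedMinor φ (σ (Sum.inl i)) with hf₁
  set f₂ : Fin e → R := fun l => signedMinor φ (σ (Sum.inr l)) with hf₂
  have hminors : minorsIdeal m φ = Ideal.span (Set.range f₁) ⊔ Ideal.span (Set.range f₂) := by
    rw [minorsIdeal_eq_span_signedMinor, ← Ideal.span_union, ← Set.Sum.elim_range,
      ← σ.surjective.range_comp]
    congr 2
    ext (i | l) <;> rfl
  have hrel : ∀ j, ∑ i, f₁ i * Φ₁ i j + ∑ l, f₂ l * Φ₂ l j = 0 := fun j => by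
    have := sum_apply_mul_signedMinor φ j
    rw [hsum] at this
    simpa [hf₁, hf₂, hΦ₁, hΦ₂, mul_comm] using this
  have hsyz : ∀ u ∈ syzygies f₁, ∃ v, Φ₂ *ᵥ v = 0 ∧ Φ₁ *ᵥ v = u := fun u hu => by
    obtain ⟨v, hv⟩ := exists_mulVec_eq_of_two_le_height φ hI.ge (u := Sum.elim u 0 ∘ σ.symm) (by
      rw [hsum]
      simpa using mem_syzygies.1 hu)
    refine ⟨v, ?_, ?_⟩ <;> ext i
    · exact (congrFun hv (σ (Sum.inr i))).trans (by simp)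
    · exact (congrFun hv (σ (Sum.inl i))).trans (by simp)
  have hsyz' : ∀ v, Φ₂ *ᵥ v = 0 → Φ₁ *ᵥ v ∈ syzygies f₁ := fun v hv => by
    have h1 : f₁ ᵥ* Φ₁ + f₂ ᵥ* Φ₂ = 0 := _root_.funext hrel
    have h2 := congrArg (· ⬝ᵥ v) h1
    simp only [add_dotProduct, ← dotProduct_mulVec, hv, dotProduct_zero, add_zero,
      zero_dotProduct] at h2
    rw [mem_syzygies]
    exact (dotProduct_comm _ _).trans h2
  have hht' : ∀ P : Ideal R, P.IsPrime → minorsIdeal e Φ₂ ≤ P → (d : ℕ∞) ≤ P.height :=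
    fun P hP hle => hht.trans (idealHeight_le_height hle)
  obtain ⟨i₀, hi₀⟩ : ∃ i, f₁ i ≠ 0 := by
    by_contra! hall
    obtain ⟨c, hc⟩ := exists_det_notMem_of_not_minorsIdeal_le (P := (⊥ : Ideal R)) (Ψ := Φ₂)
      fun h => by
        have := hht' ⊥ Ideal.isPrime_bot h
        rw [Ideal.height_bot] at this
        have : d ≤ 0 := by exact_mod_cast this
        omega
    have hJ : Ideal.span (Set.range f₁) = ⊥ := by
      rw [Ideal.span_eq_bot]
      rintro _ ⟨i, rfl⟩
      exact hall i
    have hle : minorsIdeal m φ ≤ ⊥ := fun x hx => by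
      have := det_mul_mem_of_mem_sup hrel c (hminors ▸ hx)
      rw [hJ] at this
      exact (Ideal.IsPrime.mem_or_mem Ideal.isPrime_bot this).resolve_left hc
    have := idealHeight_le_height hle
    rw [hI, Ideal.height_bot] at this
    simp at this
  rw [Ideal.isLinearType_span_range_iff, hminors]
  exact ⟨condG_of_ker_reesPresentation_eq_symIdeal hrel hht' hi₀,
    ker_reesPresentation_eq_symIdeal hde hd hrel hsyz hsyz' hht' hi₀⟩

/-- With `φ = [Φ₁; Φ₂]` an `n×(n−1)` matrix, `a = d`, `Φ₂` a nonzero block of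
linear forms, `I = I_{n−1}(φ)` of height 2, `J` generated by the `d` maximal minors of `φ`
fixing the rows of `Φ₂`, and `ht I_{n−d}(Φ₂) = d`:  `J` is an ideal of linear type if and
only if `I` satisfies condition `G_d`.  (Here `n = m + 1`.) -/
theorem statement2 {k : Type*} [Field k] [Infinite k] {d m : ℕ}
    (hd : 1 ≤ d) (hdm : d ≤ m) (ε₁ : ℕ) (hε₁ : 1 ≤ ε₁)
    (φ : Matrix (Fin (m + 1)) (Fin m) (MvPolynomial (Fin d) k))
    (Φ₁ : Matrix (Fin d) (Fin m) (MvPolynomial (Fin d) k))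
    (Φ₂ : Matrix (Fin (m + 1 - d)) (Fin m) (MvPolynomial (Fin d) k))
    (hΦ₁ : Φ₁ = φ.submatrix (fun i : Fin d =>
      (⟨(i : ℕ), by have := i.isLt; omega⟩ : Fin (m + 1))) id)
    (hΦ₂ : Φ₂ = φ.submatrix (fun i : Fin (m + 1 - d) =>
      (⟨d + (i : ℕ), by have := i.isLt; omega⟩ : Fin (m + 1))) id)
    (hdeg₁ : ∀ i j, (Φ₁ i j).IsHomogeneous ε₁)
    (hdeg₂ : ∀ i j, (Φ₂ i j).IsHomogeneous 1)
    (hne : Φ₂ ≠ 0)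
    (hI : idealHeight (minorsIdeal m φ) = 2)
    (hht : idealHeight (minorsIdeal (m + 1 - d) Φ₂) = (d : ℕ∞))
    (J : Ideal (MvPolynomial (Fin d) k))
    (hJ : J = Ideal.span (Set.range fun i : Fin d =>
      (-1) ^ (i : ℕ) *
        (φ.submatrix (Fin.succAbove (⟨(i : ℕ), by have := i.isLt; omega⟩ : Fin (m + 1))) id).det)) :
    J.IsLinearType ↔ CondG (minorsIdeal m φ) d := by
  subst hΦ₁ hΦ₂ hJ
  exact isLinearType_span_signedMinor_iff hd
    (finSumFinEquiv.trans (finCongr (by omega))) φ hI hht.ge
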